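/- arXiv:2106.15763 — 3 statements merged into one kernel-verified Lean document; each statement's English description precedes it below -/
import Mathlib

section
/- If h : closedBall(0,ε) ⊆ ℝⁿ → ℝⁿ is continuous and |h(x) − x| < ε/2 for all x with |x| = ε, then the closed ball of radius ε/2 centered at 0 is contained in the image h(closedBall(0,ε)). -/
open Metric Set Filter Topology MeasureTheory
open scoped NNReal ContDiff

section Brouwer

variable {E : Type*}

lemma bijective_add_of_lipschitzWith [NormedAddCommGroup E] [CompleteSpace E] {G : E → E}
    {K : ℝ≥0} (hG : LipschitzWith K G) (hK : K < 1) :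
    Function.Bijective fun x => x + G x := by
  have hcontr (y : E) : ContractingWith K fun x => y - G x := by
    refine ⟨hK, LipschitzWith.of_dist_le_mul fun a b => ?_⟩
    rw [dist_sub_left]
    exact hG.dist_le_mul a b
  constructor
  · intro a b hab
    have ha : Function.IsFixedPt (fun x => (b + G b) - G x) a := by
      simpa [Function.IsFixedPt, sub_eq_iff_eq_add] using hab.symm
    have hb : Function.IsFixedPt (fun x => (b + G b) - G x) b := by
      simp [Function.IsFixedPt]
    exact (hcontr _).fixedPoint_unique' ha hb
  · intro y
    refine ⟨ContractingWith.fixedPoint _ (hcontr y), ?_⟩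
    have := (hcontr y).fixedPoint_isFixedPt
    rw [Function.IsFixedPt, sub_eq_iff_eq_add] at this
    exact this.symm

/-- A Lipschitz function on a closed ball that vanishes on the sphere extends by zero to a
Lipschitz function. -/
lemma lipschitzWith_indicator_closedBall [NormedAddCommGroup E] [NormedSpace ℝ E] {g : E → E}
    {K : ℝ≥0} (hg : LipschitzOnWith K g (closedBall 0 1)) (h0 : ∀ x, ‖x‖ = 1 → g x = 0) :
    LipschitzWith (2 * K) ((closedBall (0 : E) 1).indicator g) := by
  have key {x y : E} (hx : x ∈ closedBall (0 : E) 1) (hy : y ∉ closedBall (0 : E) 1) :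
      dist (g x) 0 ≤ 2 * K * dist x y := by
    rw [mem_closedBall_zero_iff] at hx hy
    push Not at hy
    have hy0 : 0 < ‖y‖ := one_pos.trans hy
    set z := ‖y‖⁻¹ • y with hz
    have hz1 : ‖z‖ = 1 := by
      rw [hz, norm_smul, norm_inv, norm_norm, inv_mul_cancel₀ hy0.ne']
    have hyz : dist y z = ‖y‖ - 1 := by
      have : y - z = (1 - ‖y‖⁻¹) • y := by rw [sub_smul, one_smul]
      rw [dist_eq_norm, this, norm_smul, Real.norm_of_nonneg
        (sub_nonneg.2 (inv_le_one_of_one_le₀ hy.le)), sub_mul, inv_mul_cancel₀ hy0.ne', one_mul]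
    have hxy : ‖y‖ - ‖x‖ ≤ dist x y := by
      rw [dist_comm, dist_eq_norm]; exact norm_sub_norm_le y x
    have hxz : dist x z ≤ 2 * dist x y := by linarith [dist_triangle x y z]
    calc dist (g x) 0 = dist (g x) (g z) := by rw [h0 z hz1]
      _ ≤ K * dist x z := hg.dist_le_mul x (by simpa using hx) z (by simp [hz1])
      _ ≤ K * (2 * dist x y) := by gcongr
      _ = 2 * K * dist x y := by ring
  refine LipschitzWith.of_dist_le_mul fun x y => ?_
  push_cast
  by_cases hx : x ∈ closedBall (0 : E) 1 <;> by_cases hy : y ∈ closedBall (0 : E) 1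
  · rw [indicator_of_mem hx, indicator_of_mem hy]
    have := hg.dist_le_mul x hx y hy
    have : 0 ≤ K * dist x y := by positivity
    linarith
  · rw [indicator_of_mem hx, indicator_of_notMem hy]
    exact key hx hy
  · rw [indicator_of_notMem hx, indicator_of_mem hy, dist_comm, dist_comm x]
    exact key hy hx
  · rw [indicator_of_notMem hx, indicator_of_notMem hy, dist_self]
    positivity

lemma bijOn_closedBall_add_smul [NormedAddCommGroup E] [NormedSpace ℝ E] [CompleteSpace E]
    {g : E → E} {K : ℝ≥0} (hg : LipschitzOnWith K g (closedBall 0 1))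
    (h0 : ∀ x, ‖x‖ = 1 → g x = 0) {t : ℝ≥0} (ht : t * (2 * K) < 1) :
    BijOn (fun x => x + (t : ℝ) • g x) (closedBall 0 1) (closedBall 0 1) := by
  set B := closedBall (0 : E) 1
  set F : E → E := fun x => x + (t : ℝ) • B.indicator g x
  have hF : Function.Bijective F := by
    refine bijective_add_of_lipschitzWith (K := t * (2 * K)) ?_ ht
    refine LipschitzWith.of_dist_le_mul fun x y => ?_
    rw [dist_smul₀, NNReal.coe_mul, mul_assoc, Real.norm_of_nonneg t.coe_nonneg]
    gcongr
    exact (lipschitzWith_indicator_closedBall hg h0).dist_le_mul x y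
  have hEq : EqOn F (fun x => x + (t : ℝ) • g x) B := fun x hx => by
    simp only [F, indicator_of_mem hx]
  have hcompl : F '' Bᶜ = Bᶜ := by
    have : EqOn F id Bᶜ := fun x hx => by simp [F, indicator_of_notMem hx]
    rw [this.image_eq, image_id]
  have himage : F '' B = B := by
    rw [← compl_inj_iff, ← image_compl_eq hF, hcompl]
  exact (BijOn.mk (fun x hx => himage ▸ mem_image_of_mem F hx) hF.1.injOn
    himage.ge).congr hEq

/-- `det (1 + t A)` is a polynomial in `t` of degree at most `n`, so its value at any `t` is
determined by Lagrange interpolation from its values at `n + 1` nodes. -/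
lemma det_one_add_smul_eq_sum [NormedAddCommGroup E] [NormedSpace ℝ E] [FiniteDimensional ℝ E]
    {ι : Type*} [DecidableEq ι] {s : Finset ι} {v : ι → ℝ} (hv : InjOn v s)
    (hs : Module.finrank ℝ E < s.card) (A : E →L[ℝ] E) (t : ℝ) :
    (1 + t • A).det = ∑ i ∈ s, (1 + v i • A).det * (Lagrange.basis s v i).eval t := by
  classical
  let b := Module.finBasis ℝ E
  let M := LinearMap.toMatrix b b (A : E →ₗ[ℝ] E)
  let p : Polynomial ℝ :=
    ((Polynomial.X : Polynomial ℝ) • M.map Polynomial.C +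
      (1 : Matrix _ _ ℝ).map Polynomial.C).det
  have hp (u : ℝ) : (1 + u • A).det = p.eval u := by
    have h1 : LinearMap.toMatrix b b ((1 + u • A : E →L[ℝ] E) : E →ₗ[ℝ] E) = 1 + u • M := by
      have : ((1 + u • A : E →L[ℝ] E) : E →ₗ[ℝ] E) = 1 + u • (A : E →ₗ[ℝ] E) := rfl
      rw [this, map_add, map_smul, LinearMap.toMatrix_one]
    rw [ContinuousLinearMap.det, ← LinearMap.det_toMatrix b, h1, ← Polynomial.coe_evalRingHom,
      RingHom.map_det]
    congr 1
    ext i j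
    by_cases hij : i = j <;> simp [hij, add_comm, mul_comm u]
  have hdeg : p.degree < s.card := by
    refine Polynomial.degree_le_natDegree.trans_lt (Nat.cast_lt.2 (lt_of_le_of_lt ?_ hs))
    exact (Polynomial.natDegree_det_X_add_C_le M 1).trans_eq (Fintype.card_fin _)
  rw [hp, Lagrange.eq_interpolate hv hdeg, Lagrange.interpolate_apply, Polynomial.eval_finsetSum]
  simp [hp]

lemma det_fderiv_eq_zero_of_norm_eventuallyEq_one [NormedAddCommGroup E] [InnerProductSpace ℝ E]
    [FiniteDimensional ℝ E] {r : E → E} {x : E} (hr : DifferentiableAt ℝ r x)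
    (hn : ∀ᶠ y in 𝓝 x, ‖r y‖ = 1) : (fderiv ℝ r x).det = 0 := by
  by_contra hdet
  obtain ⟨v, hv⟩ : ∃ v, fderiv ℝ r x v = r x :=
    ((LinearMap.equivOfDetNeZero (fderiv ℝ r x : E →ₗ[ℝ] E) hdet).surjective (r x))
  have hconst : (fun y => ‖r y‖ ^ 2) =ᶠ[𝓝 x] fun _ => (1 : ℝ) := by
    filter_upwards [hn] with y hy
    rw [hy, one_pow]
  have h1 := (hr.hasFDerivAt.norm_sq).unique
    ((hasFDerivAt_const (1 : ℝ) x).congr_of_eventuallyEq hconst)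
  have h2 := congrArg (fun L => L v) h1
  simp [hv, hn.self_of_nhds] at h2

/-- There is no `C¹` retraction of the closed unit ball onto the unit sphere. -/
theorem not_contDiffOn_retraction_sphere [NormedAddCommGroup E] [InnerProductSpace ℝ E]
    [FiniteDimensional ℝ E] {r : E → E} {U : Set E} (hU : IsOpen U) (hBU : closedBall 0 1 ⊆ U)
    (hr : ContDiffOn ℝ 1 r U) (hn : ∀ x ∈ U, ‖r x‖ = 1) (hid : ∀ x, ‖x‖ = 1 → r x = x) :
    False := by
  borelize E
  let μ : Measure E := Measure.addHaar
  set B := closedBall (0 : E) 1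
  have hBc : IsCompact B := isCompact_closedBall 0 1
  set g : E → E := fun x => r x - x
  have hg0 (x : E) (hx : ‖x‖ = 1) : g x = 0 := sub_eq_zero.2 (hid x hx)
  obtain ⟨K, hK⟩ : ∃ K, LipschitzOnWith K g B :=
    ((hr.mono hBU).sub contDiffOn_id).exists_lipschitzOnWith one_ne_zero
      (convex_closedBall 0 1) hBc
  have hdiff (x : E) (hx : x ∈ B) : DifferentiableAt ℝ r x :=
    (hr.differentiableOn one_ne_zero).differentiableAt (hU.mem_nhds (hBU hx))
  set A : E → E →L[ℝ] E := fun x => fderiv ℝ r x - 1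
  have hgA (x : E) (hx : x ∈ B) : HasFDerivAt g (A x) x :=
    (hdiff x hx).hasFDerivAt.sub (hasFDerivAt_id x)
  have hAc : ContinuousOn A B :=
    ((hr.continuousOn_fderiv_of_isOpen hU le_rfl).mono hBU).sub continuousOn_const
  have hdetc (t : ℝ) : ContinuousOn (fun x => (1 + t • A x).det) B :=
    ContinuousLinearMap.continuous_det.comp_continuousOn
      (continuousOn_const.add (hAc.const_smul t))
  have hdeti (t : ℝ) : IntegrableOn (fun x => (1 + t • A x).det) B μ :=
    (hdetc t).integrableOn_compact hBc
  obtain ⟨C, hC⟩ := hBc.exists_bound_of_continuousOn hAc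
  obtain ⟨η, hη, hdetpos⟩ : ∃ η > 0, ∀ T : E →L[ℝ] E, ‖T‖ < η → 0 < (1 + T).det := by
    have h1 : ContinuousAt (fun T : E →L[ℝ] E => (1 + T).det) 0 :=
      (ContinuousLinearMap.continuous_det.comp (continuous_const.add continuous_id)).continuousAt
    have h2 : ∀ᶠ T in 𝓝 (0 : E →L[ℝ] E), 0 < (1 + T).det := by
      refine h1.eventually (lt_mem_nhds ?_)
      simp only [add_zero]
      exact one_pos.trans_eq (LinearMap.det_id (M := E) (A := ℝ)).symm
    obtain ⟨η, hη, h⟩ := Metric.eventually_nhds_iff.1 h2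
    exact ⟨η, hη, fun T hT => h (by simpa using hT)⟩
  obtain ⟨δ, hδ, hδK, hδC⟩ : ∃ δ : ℝ≥0, 0 < δ ∧ δ * (2 * K) < 1 ∧ (δ : ℝ) * |C| < η := by
    have h1 : Tendsto (fun δ : ℝ≥0 => δ * (2 * K)) (𝓝[>] 0) (𝓝 0) := by
      have : Continuous fun δ : ℝ≥0 => δ * (2 * K) := by fun_prop
      simpa using (this.tendsto 0).mono_left nhdsWithin_le_nhds
    have h2 : Tendsto (fun δ : ℝ≥0 => (δ : ℝ) * |C|) (𝓝[>] 0) (𝓝 0) := by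
      have : Continuous fun δ : ℝ≥0 => (δ : ℝ) * |C| := by fun_prop
      simpa using (this.tendsto 0).mono_left nhdsWithin_le_nhds
    exact ((eventually_mem_nhdsWithin (a := (0 : ℝ≥0)) (s := Ioi 0)).and
      ((h1.eventually_lt_const one_pos).and (h2.eventually_lt_const hη))).exists
  have hvol (t : ℝ≥0) (ht : t ≤ δ) : ∫ x in B, (1 + (t : ℝ) • A x).det ∂μ = μ.real B := by
    have hbij := bijOn_closedBall_add_smul hK hg0 (t := t) (lt_of_le_of_lt (by gcongr) hδK)
    have hcv := integral_image_eq_integral_abs_det_fderiv_smul μ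
      (f' := fun x => 1 + (t : ℝ) • A x) hBc.measurableSet
      (fun x hx => ((hasFDerivAt_id x).add ((hgA x hx).const_smul (t : ℝ))).hasFDerivWithinAt)
      hbij.injOn (fun _ => (1 : ℝ))
    have himage : (id + (t : ℝ) • g) '' B = B := hbij.image_eq
    calc ∫ x in B, (1 + (t : ℝ) • A x).det ∂μ
        = ∫ x in B, |(1 + (t : ℝ) • A x).det| • (1 : ℝ) ∂μ := by
          refine setIntegral_congr_fun hBc.measurableSet fun x hx => ?_
          have : ‖(t : ℝ) • A x‖ < η := by
            rw [norm_smul, Real.norm_of_nonneg t.coe_nonneg]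
            refine lt_of_le_of_lt ?_ hδC
            gcongr
            exact (hC x hx).trans (le_abs_self C)
          simp [abs_of_pos (hdetpos _ this)]
      _ = ∫ x in B, (1 : ℝ) ∂μ := by rw [← hcv, himage]
      _ = μ.real B := by simp
  set s := Finset.range (Module.finrank ℝ E + 1)
  set v : ℕ → ℝ≥0 := fun i => δ / (i + 1)
  have hv : InjOn (fun i => (v i : ℝ)) s := by
    intro i _ j _ hij
    have hij : v i = v j := NNReal.coe_injective hij
    simp only [v] at hij
    rw [div_eq_mul_inv, div_eq_mul_inv, mul_right_inj' hδ.ne', inv_inj, add_left_inj,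
      Nat.cast_inj] at hij
    exact hij
  have hvδ (i : ℕ) : v i ≤ δ := div_le_self zero_le (by simp)
  have hone : ∫ x in B, (1 + (1 : ℝ) • A x).det ∂μ = μ.real B := by
    have hexpand (x : E) := det_one_add_smul_eq_sum hv (by simp [s]) (A x) 1
    simp_rw [hexpand]
    rw [integral_finsetSum _ fun i _ => (hdeti (v i)).mul_const _]
    simp_rw [integral_mul_const, hvol _ (hvδ _)]
    rw [← Finset.mul_sum, ← Polynomial.eval_finsetSum, Lagrange.sum_basis hv (by simp [s])]
    simp
  have hzero : ∫ x in B, (1 + (1 : ℝ) • A x).det ∂μ = 0 := by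
    refine setIntegral_eq_zero_of_forall_eq_zero fun x hx => ?_
    rw [one_smul, add_sub_cancel]
    exact det_fderiv_eq_zero_of_norm_eventuallyEq_one (hdiff x hx)
      (by filter_upwards [hU.mem_nhds (hBU hx)] using hn)
  have hpos : 0 < μ.real B :=
    ENNReal.toReal_pos (measure_closedBall_pos μ 0 one_pos).ne' hBc.measure_lt_top.ne
  linarith

lemma exists_fixedPoint_of_contDiff [NormedAddCommGroup E] [InnerProductSpace ℝ E]
    [FiniteDimensional ℝ E] {q : E → E} (hq : ContDiff ℝ 1 q)
    (hlt : ∀ x ∈ closedBall (0 : E) 1, ‖q x‖ < 1) : ∃ x ∈ closedBall (0 : E) 1, q x = x := by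
  by_contra! hne
  -- The retraction sends `x` to the point where the ray from `q x` through `x` leaves the ball.
  set u : E → E := fun x => x - q x
  set b : E → ℝ := fun x => inner ℝ x (u x)
  set D : E → ℝ := fun x => b x ^ 2 + ‖u x‖ ^ 2 * (1 - ‖x‖ ^ 2)
  set r : E → E := fun x => x + ((-b x + √(D x)) / ‖u x‖ ^ 2) • u x
  have hu : ContDiff ℝ 1 u := contDiff_id.sub hq
  have hb : ContDiff ℝ 1 b := contDiff_id.inner ℝ hu
  have hD : ContDiff ℝ 1 D :=
    (hb.pow 2).add ((hu.norm_sq ℝ).mul (contDiff_const.sub (contDiff_id.norm_sq ℝ)))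
  have hu0 (x : E) (hx : x ∈ closedBall (0 : E) 1) : u x ≠ 0 :=
    sub_ne_zero.2 (hne x hx).symm
  have hbpos (x : E) (hx : ‖x‖ = 1) : 0 < b x := by
    have h1 : inner ℝ x (q x) ≤ ‖x‖ * ‖q x‖ := real_inner_le_norm x (q x)
    have h2 := hlt x (by simp [hx])
    simp only [b, u, inner_sub_right, real_inner_self_eq_norm_sq]
    rw [hx] at h1 ⊢
    linarith
  refine not_contDiffOn_retraction_sphere (r := r) (U := {x | u x ≠ 0} ∩ {x | 0 < D x})
    ((isOpen_ne_fun hu.continuous continuous_const).inter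
      (isOpen_lt continuous_const hD.continuous)) ?_ ?_ ?_ ?_
  · intro x hx
    refine ⟨hu0 x hx, ?_⟩
    have hux : 0 < ‖u x‖ ^ 2 := by have := norm_pos_iff.2 (hu0 x hx); positivity
    have hx1 : ‖x‖ ≤ 1 := by simpa using hx
    change 0 < b x ^ 2 + ‖u x‖ ^ 2 * (1 - ‖x‖ ^ 2)
    rcases hx1.lt_or_eq with h | h
    · have : 0 < 1 - ‖x‖ ^ 2 := by nlinarith [norm_nonneg x]
      positivity
    · have := hbpos x h
      rw [h]
      positivity
  · rintro x ⟨hux, hDx⟩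
    have hux' : ‖u x‖ ^ 2 ≠ 0 := pow_ne_zero 2 (norm_ne_zero_iff.2 hux)
    exact (contDiffAt_id.add (((hb.contDiffAt.neg.add (hD.contDiffAt.sqrt (ne_of_gt hDx))).div
      (hu.norm_sq ℝ).contDiffAt hux').smul hu.contDiffAt)).contDiffWithinAt
  · rintro x ⟨hux, hDx⟩
    have hux' : ‖u x‖ ^ 2 ≠ 0 := pow_ne_zero 2 (norm_ne_zero_iff.2 hux)
    set c := (-b x + √(D x)) / ‖u x‖ ^ 2 with hc
    have hroot : ‖u x‖ ^ 2 * c + b x = √(D x) := by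
      rw [hc, mul_div_cancel₀ _ hux']
      ring
    have hsq : (‖u x‖ ^ 2 * c + b x) ^ 2 = b x ^ 2 + ‖u x‖ ^ 2 * (1 - ‖x‖ ^ 2) := by
      rw [hroot, Real.sq_sqrt (le_of_lt hDx)]
    have hnorm : ‖r x‖ ^ 2 = 1 := by
      have : ‖r x‖ ^ 2 = ‖x‖ ^ 2 + 2 * (c * b x) + c ^ 2 * ‖u x‖ ^ 2 := by
        change ‖x + c • u x‖ ^ 2 = _
        rw [norm_add_sq_real, real_inner_smul_right, norm_smul, mul_pow, Real.norm_eq_abs, sq_abs]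
      rw [this]
      apply mul_left_cancel₀ hux'
      linear_combination hsq
    exact (pow_eq_one_iff_of_nonneg (norm_nonneg _) two_ne_zero).1 hnorm
  · intro x hx
    have : √(D x) = b x := by
      simp only [D, hx, one_pow, sub_self, mul_zero, add_zero]
      exact Real.sqrt_sq (hbpos x hx).le
    simp [r, this]

/-- **Brouwer fixed point theorem** for a continuous map into the closed unit ball. -/
theorem exists_fixedPoint_of_continuous_of_norm_le_one [NormedAddCommGroup E]
    [InnerProductSpace ℝ E] [FiniteDimensional ℝ E] {f : E → E} (hf : Continuous f)
    (hle : ∀ x, ‖f x‖ ≤ 1) : ∃ x, f x = x := by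
  by_contra! hne
  have hBc : IsCompact (closedBall (0 : E) 1) := isCompact_closedBall 0 1
  obtain ⟨x₀, -, hx₀⟩ := hBc.exists_isMinOn ⟨0, by simp⟩
    (f := fun x => ‖f x - x‖) (by fun_prop)
  set d := ‖f x₀ - x₀‖ / 2
  have hd : 0 < d := half_pos (norm_pos_iff.2 (sub_ne_zero.2 (hne x₀)))
  obtain ⟨p, hp, hpf⟩ : ∃ p : E → E, ContDiff ℝ ∞ p ∧
      ∀ x ∈ closedBall (0 : E) 1, ‖p x - f x‖ < d := by
    have hdense := ContinuousMap.dense_setOfPred_contDiff (E := E) (F := E) ⟨f, hf⟩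
    rw [mem_closure_iff_nhds_basis
      (nhds_basis_uniformity uniformity_basis_dist.compactConvergenceUniformity)] at hdense
    obtain ⟨p, hp, hpf⟩ := hdense (closedBall 0 1, d) ⟨hBc, hd⟩
    exact ⟨p, hp, fun x hx => by simpa [dist_eq_norm] using hpf x hx⟩
  have hp_lt (x : E) (hx : x ∈ closedBall (0 : E) 1) : ‖p x‖ < 1 + d := by
    have := norm_le_norm_add_norm_sub' (p x) (f x)
    linarith [hpf x hx, hle x]
  have h1d : 0 < 1 + d := by positivity
  obtain ⟨x, hx, hfix⟩ := exists_fixedPoint_of_contDiff (q := fun x => (1 + d)⁻¹ • p x)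
    ((hp.of_le (by exact_mod_cast le_top)).const_smul _) fun x hx => by
      rw [norm_smul, norm_inv, Real.norm_of_nonneg h1d.le, inv_mul_lt_one₀ h1d]
      exact hp_lt x hx
  have hpx : p x = (1 + d) • x := by
    rw [← hfix, smul_smul, mul_inv_cancel₀ h1d.ne', one_smul, hfix]
  have hpx' : ‖p x - x‖ ≤ d := by
    have : p x - x = d • x := by rw [hpx, add_smul, one_smul, add_sub_cancel_left]
    rw [this, norm_smul, Real.norm_of_nonneg hd.le]
    exact mul_le_of_le_one_right hd.le (by simpa using hx)
  have hmin : ‖f x₀ - x₀‖ ≤ ‖f x - x‖ := hx₀ hx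
  have htri := norm_sub_le_norm_sub_add_norm_sub (f x) (p x) x
  rw [norm_sub_rev (f x) (p x)] at htri
  have : d + d = ‖f x₀ - x₀‖ := add_halves _
  linarith [hpf x hx]

end Brouwer

/-- If `h` is continuous on the closed ball of radius `ε` about `0` in ℝⁿ and
`‖h x − x‖ < ε/2` on the sphere `‖x‖ = ε`, then the closed ball of radius `ε/2`
is contained in the image of the closed ball of radius `ε`. -/
theorem stmt_2 {n : ℕ} (ε : ℝ) (hε : 0 < ε)
    (h : EuclideanSpace ℝ (Fin n) → EuclideanSpace ℝ (Fin n))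
    (hc : ContinuousOn h (Metric.closedBall 0 ε))
    (hb : ∀ x : EuclideanSpace ℝ (Fin n), ‖x‖ = ε → ‖h x - x‖ < ε / 2) :
    Metric.closedBall (0 : EuclideanSpace ℝ (Fin n)) (ε / 2) ⊆
      h '' Metric.closedBall 0 ε := by
  intro y hy
  rw [mem_closedBall_zero_iff] at hy
  set P : EuclideanSpace ℝ (Fin n) → EuclideanSpace ℝ (Fin n) := fun z => (max 1 ‖z‖)⁻¹ • z with hP
  have hmax (z : EuclideanSpace ℝ (Fin n)) : 0 < max 1 ‖z‖ := lt_max_of_lt_left one_pos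
  have hPc : Continuous P :=
    ((continuous_const.max continuous_norm).inv₀ fun z => (hmax z).ne').smul continuous_id
  have hPnorm (z : EuclideanSpace ℝ (Fin n)) : ‖P z‖ = (max 1 ‖z‖)⁻¹ * ‖z‖ := by
    rw [hP, norm_smul, norm_inv, Real.norm_of_nonneg (hmax z).le]
  have hPle (z : EuclideanSpace ℝ (Fin n)) : ‖P z‖ ≤ 1 := by
    rw [hPnorm, inv_mul_le_one₀ (hmax z)]
    exact le_max_right _ _
  have hPid {z : EuclideanSpace ℝ (Fin n)} (hz : ‖z‖ ≤ 1) : P z = z := by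
    simp [hP, max_eq_left hz]
  set w : EuclideanSpace ℝ (Fin n) → EuclideanSpace ℝ (Fin n) :=
    fun z => z + ε⁻¹ • (y - h (ε • z)) with hw
  have hmem {z : EuclideanSpace ℝ (Fin n)} (hz : ‖z‖ ≤ 1) :
      ε • z ∈ closedBall (0 : EuclideanSpace ℝ (Fin n)) ε := by
    rw [mem_closedBall_zero_iff, norm_smul, Real.norm_of_nonneg hε.le]
    exact mul_le_of_le_one_right hε.le hz
  have hwc : Continuous fun z => w (P z) := by
    have hhc : Continuous fun z => h (ε • P z) :=
      hc.comp_continuous (hPc.const_smul ε) fun z => hmem (hPle z)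
    have hsub : Continuous fun z => y - h (ε • P z) := by
      exact continuous_const.sub hhc
    exact hPc.add (hsub.const_smul ε⁻¹)
  obtain ⟨z, hz⟩ := exists_fixedPoint_of_continuous_of_norm_le_one
    (hPc.comp hwc) fun z => hPle _
  have hz1 : ‖z‖ ≤ 1 := hz ▸ hPle _
  rw [Function.comp_apply, hPid hz1] at hz
  refine ⟨ε • z, hmem hz1, ?_⟩
  by_cases hwz : ‖w z‖ ≤ 1
  · rw [hPid hwz, hw, add_eq_left, smul_eq_zero_iff_right (inv_ne_zero hε.ne'), sub_eq_zero] at hz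
    exact hz.symm
  · push Not at hwz
    have hznorm : ‖z‖ = 1 := by
      rw [← hz, hPnorm, max_eq_right hwz.le, inv_mul_cancel₀ (one_pos.trans hwz).ne']
    have hbz := hb (ε • z) (by rw [norm_smul, Real.norm_of_nonneg hε.le, hznorm, mul_one])
    have hεw : ε • w z = y - (h (ε • z) - ε • z) := by
      rw [hw, smul_add, smul_smul, mul_inv_cancel₀ hε.ne', one_smul]
      abel
    have hle := norm_sub_le y (h (ε • z) - ε • z)
    rw [← hεw, norm_smul, Real.norm_of_nonneg hε.le] at hle
    nlinarith
end

section
/- Let γ : [0,1] → ℝ² be a closed Lipschitz curve (γ(0)=γ(1)) and let Γ = (Γ₁,Γ₂) : closed unit disk → ℝ² be any Lipschitz extension of γ (interpreted via the boundary parametrization t ↦ e^{2πit}). Then the oriented enclosed area satisfies A(γ) = ∫₀¹ γ₁ γ₂′ dt = ∫_{𝔹²} det DΓ(x) dx. -/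
open Set MeasureTheory

open Filter Topology

theorem integral_mul_deriv_sub_integral_mul_deriv {f₀ f₁ g₀ g₁ : ℝ → ℝ} {a b : ℝ}
    (hf₀ : AbsolutelyContinuousOnInterval f₀ a b) (hf₁ : AbsolutelyContinuousOnInterval f₁ a b)
    (hg₀ : AbsolutelyContinuousOnInterval g₀ a b) (hg₁ : AbsolutelyContinuousOnInterval g₁ a b)
    (hf : f₀ a = f₀ b) (hg₀' : g₀ a = g₀ b) (hg₁' : g₁ a = g₁ b) :
    (∫ x in a..b, f₁ x * deriv g₁ x) - ∫ x in a..b, f₀ x * deriv g₀ x =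
      (∫ x in a..b, (f₁ x - f₀ x) * deriv g₁ x) - ∫ x in a..b, deriv f₀ x * (g₁ x - g₀ x) := by
  have h₁ := hf₀.integral_mul_deriv_eq_deriv_mul hg₁
  have h₀ := hf₀.integral_mul_deriv_eq_deriv_mul hg₀
  simp only [sub_mul, mul_sub]
  rw [intervalIntegral.integral_sub (hg₁.intervalIntegrable_deriv.continuousOn_mul hf₁.continuousOn)
      (hg₁.intervalIntegrable_deriv.continuousOn_mul hf₀.continuousOn),
    intervalIntegral.integral_sub (hf₀.intervalIntegrable_deriv.mul_continuousOn hg₁.continuousOn)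
      (hf₀.intervalIntegrable_deriv.mul_continuousOn hg₀.continuousOn), h₀, h₁, hf, hg₀', hg₁']
  ring

theorem tendsto_inv_mul_integral_comp_add_sub {a : ℝ → ℝ} (ha : Continuous a) (x y : ℝ) :
    Tendsto (fun h => h⁻¹ * ∫ r in x..y, (a (r + h) - a r)) (𝓝[≠] 0) (𝓝 (a y - a x)) := by
  have key : ∀ z, Tendsto (fun h : ℝ => h⁻¹ • ((∫ r in x..z + h, a r) - ∫ r in x..z, a r))
      (𝓝[≠] 0) (𝓝 (a z)) := fun z =>
    (intervalIntegral.integral_hasDerivAt_right (ha.intervalIntegrable _ _)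
      (ha.stronglyMeasurableAtFilter _ _) ha.continuousAt).tendsto_slope_zero
  refine ((key y).sub (key x)).congr fun h => ?_
  rw [intervalIntegral.integral_sub
    ((show Continuous fun r => a (r + h) by fun_prop).intervalIntegrable _ _)
    (ha.intervalIntegrable _ _), intervalIntegral.integral_comp_add_right (fun r => a r),
    ← intervalIntegral.integral_interval_sub_left (ha.intervalIntegrable x (y + h))
      (ha.intervalIntegrable x (x + h))]
  simp only [smul_eq_mul, intervalIntegral.integral_same]
  ring

theorem LipschitzWith.abs_diffQuot_fst_le {u : ℝ × ℝ → ℝ} {K : NNReal} (hu : LipschitzWith K u)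
    (p : ℝ × ℝ) (h : ℝ) : |h⁻¹ * (u (p.1 + h, p.2) - u p)| ≤ K := by
  rcases eq_or_ne h 0 with rfl | hh
  · simp
  have := hu.dist_le_mul (p.1 + h, p.2) p
  rw [Real.dist_eq, Prod.dist_eq] at this
  simp only [Real.dist_eq, add_sub_cancel_left, sub_self, abs_zero, abs_nonneg, sup_of_le_left]
    at this
  rw [abs_mul, abs_inv, inv_mul_le_iff₀ (abs_pos.2 hh)]
  linarith

theorem tendsto_integral_diffQuot_fst_mul {u w : ℝ × ℝ → ℝ} {K : NNReal} {C : ℝ}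
    (hu : LipschitzWith K u) (hw : Measurable w) (hwC : ∀ p, |w p| ≤ C)
    {μ : Measure (ℝ × ℝ)} [IsFiniteMeasure μ] (hμ : μ ≪ volume) :
    Tendsto (fun h => ∫ p, h⁻¹ * (u (p.1 + h, p.2) - u p) * w p ∂μ) (𝓝[≠] 0)
      (𝓝 (∫ p, fderiv ℝ u p (1, 0) * w p ∂μ)) := by
  have huc := hu.continuous
  refine tendsto_integral_filter_of_dominated_convergence (fun _ => K * C) ?_ ?_
    (integrable_const _) ?_
  · refine Eventually.of_forall fun h => Measurable.aestronglyMeasurable ?_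
    exact Measurable.mul (Continuous.measurable (by fun_prop)) hw
  · refine Eventually.of_forall fun h => Eventually.of_forall fun p => ?_
    rw [norm_mul]
    exact mul_le_mul (hu.abs_diffQuot_fst_le p h) (hwC p) (abs_nonneg _) K.2
  · filter_upwards [hμ.ae_le hu.ae_differentiableAt] with p hp
    refine Tendsto.mul_const _ ?_
    have hd : HasDerivAt (fun s => u (s, p.2)) (fderiv ℝ u p (1, 0)) p.1 :=
      HasFDerivAt.comp_hasDerivAt (f := fun s => (s, p.2)) (x := p.1) hp.hasFDerivAt
        ((hasDerivAt_id p.1).prodMk (hasDerivAt_const p.1 p.2))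
    exact hd.tendsto_slope_zero

theorem LipschitzWith.comp_prodMk_left {u : ℝ × ℝ → ℝ} {K : NNReal} (hu : LipschitzWith K u)
    (r : ℝ) : LipschitzWith K (fun s => u (r, s)) := by
  simpa [Function.comp_def] using hu.comp (LipschitzWith.prodMk_left r)

theorem LipschitzWith.absolutelyContinuousOnInterval {f : ℝ → ℝ} {K : NNReal}
    (hf : LipschitzWith K f) (a b : ℝ) : AbsolutelyContinuousOnInterval f a b :=
  (hf.lipschitzOnWith (s := uIcc a b)).absolutelyContinuousOnInterval

theorem LipschitzWith.integral_det_rectangle {u v : ℝ × ℝ → ℝ} {K L : NNReal}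
    (hu : LipschitzWith K u) (hv : LipschitzWith L v) {x y α β : ℝ} (hxy : x ≤ y) (hαβ : α ≤ β)
    (hu' : ∀ r, u (r, α) = u (r, β)) (hv' : ∀ r, v (r, α) = v (r, β)) :
    ∫ p in Ioc x y ×ˢ Ioc α β, (fderiv ℝ u p (1, 0) * fderiv ℝ v p (0, 1) -
        fderiv ℝ u p (0, 1) * fderiv ℝ v p (1, 0)) =
      (∫ θ in α..β, u (y, θ) * deriv (fun s => v (y, s)) θ) -
        ∫ θ in α..β, u (x, θ) * deriv (fun s => v (x, s)) θ := by
  have huc := hu.continuous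
  have hvc := hv.continuous
  set U : ℝ × ℝ → ℝ := fun p => deriv (fun s => u (p.1, s)) p.2 with hU
  set V : ℝ × ℝ → ℝ := fun p => deriv (fun s => v (p.1, s)) p.2 with hV
  have hUm : Measurable U := measurable_deriv_with_param (f := fun r s => u (r, s)) huc
  have hVm : Measurable V := measurable_deriv_with_param (f := fun r s => v (r, s)) hvc
  have hUK : ∀ p, |U p| ≤ K := fun p => norm_deriv_le_of_lipschitz (hu.comp_prodMk_left p.1)
  have hVL : ∀ p, |V p| ≤ L := fun p => norm_deriv_le_of_lipschitz (hv.comp_prodMk_left p.1)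
  set a : ℝ → ℝ := fun r => ∫ θ in α..β, u (r, θ) * V (r, θ) with ha
  have hsub : ∀ r s, a s - a r = (∫ θ in α..β, (u (s, θ) - u (r, θ)) * V (s, θ)) -
      ∫ θ in α..β, U (r, θ) * (v (s, θ) - v (r, θ)) := fun r s =>
    integral_mul_deriv_sub_integral_mul_deriv
      ((hu.comp_prodMk_left r).absolutelyContinuousOnInterval _ _)
      ((hu.comp_prodMk_left s).absolutelyContinuousOnInterval _ _)
      ((hv.comp_prodMk_left r).absolutelyContinuousOnInterval _ _)
      ((hv.comp_prodMk_left s).absolutelyContinuousOnInterval _ _) (hu' r) (hv' r) (hv' s)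
  -- the difference quotients of `u` and `v`, integrated in the angular variable
  set G : ℝ → ℝ → ℝ := fun h r => ∫ θ in α..β, h⁻¹ * (u (r + h, θ) - u (r, θ)) * V (r, θ) with hG
  set H : ℝ → ℝ → ℝ := fun h r => ∫ θ in α..β, h⁻¹ * (v (r + h, θ) - v (r, θ)) * U (r, θ) with hH
  have hGb : ∀ h r, ‖G h r‖ ≤ K * L * (β - α) := fun h r => by
    rw [← abs_of_nonneg (sub_nonneg.2 hαβ)]
    refine intervalIntegral.norm_integral_le_of_norm_le_const fun θ _ => ?_
    rw [norm_mul]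
    exact mul_le_mul (hu.abs_diffQuot_fst_le (r, θ) h) (hVL _) (abs_nonneg _) K.2
  have hHb : ∀ h r, ‖H h r‖ ≤ L * K * (β - α) := fun h r => by
    rw [← abs_of_nonneg (sub_nonneg.2 hαβ)]
    refine intervalIntegral.norm_integral_le_of_norm_le_const fun θ _ => ?_
    rw [norm_mul]
    exact mul_le_mul (hv.abs_diffQuot_fst_le (r, θ) h) (hUK _) (abs_nonneg _) L.2
  have hquot : ∀ h ≠ 0, ∀ r, h⁻¹ * (a (r + h) - a r) = G (-h) (r + h) - H h r := fun h hh r => by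
    rw [hsub r (r + h), mul_sub, ← intervalIntegral.integral_const_mul,
      ← intervalIntegral.integral_const_mul]
    congr 1
    · refine intervalIntegral.integral_congr fun θ _ => ?_
      simp only [add_neg_cancel_right, inv_neg]
      ring
    · refine intervalIntegral.integral_congr fun θ _ => ?_
      ring
  have hac : Continuous a := by
    have : LipschitzWith (Real.toNNReal (K * L * (β - α) + L * K * (β - α))) a := by
      refine LipschitzWith.of_dist_le_mul fun s r => ?_
      have hC : 0 ≤ K * L * (β - α) + L * K * (β - α) :=
        add_nonneg ((norm_nonneg _).trans (hGb 0 0)) ((norm_nonneg _).trans (hHb 0 0))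
      rw [Real.coe_toNNReal _ hC, Real.dist_eq, Real.dist_eq]
      rcases eq_or_ne s r with rfl | hsr
      · simp
      have h1 := hquot (s - r) (sub_ne_zero.2 hsr) r
      have h2 := (_root_.norm_sub_le _ _).trans
        (add_le_add (hGb (-(s - r)) (r + (s - r))) (hHb (s - r) r))
      rw [← h1, norm_mul, norm_inv, inv_mul_le_iff₀ (norm_pos_iff.2 (sub_ne_zero.2 hsr)),
        add_sub_cancel] at h2
      rwa [mul_comm] at h2
    exact this.continuous
  have hmeas : ∀ {f w : ℝ × ℝ → ℝ}, Continuous f → Measurable w → ∀ h : ℝ,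
      Measurable fun p : ℝ × ℝ => h⁻¹ * (f (p.1 + h, p.2) - f p) * w p := fun hf hw h =>
    Measurable.mul (Continuous.measurable (by fun_prop)) hw
  have hGi : ∀ h s t, IntervalIntegrable (G h) volume s t := fun h s t => by
    refine (intervalIntegrable_const (c := K * L * (β - α))).mono_fun' ?_
      (Eventually.of_forall (hGb h))
    simp only [hG, intervalIntegral.integral_of_le hαβ]
    exact (hmeas huc hVm h).stronglyMeasurable.integral_prod_right.aestronglyMeasurable
  have hHi : ∀ h s t, IntervalIntegrable (H h) volume s t := fun h s t => by
    refine (intervalIntegrable_const (c := L * K * (β - α))).mono_fun' ?_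
      (Eventually.of_forall (hHb h))
    simp only [hH, intervalIntegral.integral_of_le hαβ]
    exact (hmeas hvc hUm h).stronglyMeasurable.integral_prod_right.aestronglyMeasurable
  set μ : Measure (ℝ × ℝ) := volume.restrict (Ioc x y ×ˢ Ioc α β) with hμ
  have hμ' : μ = (volume.restrict (Ioc x y)).prod (volume.restrict (Ioc α β)) := by
    rw [hμ, Measure.volume_eq_prod, Measure.prod_restrict]
  have hfin : IsFiniteMeasure μ := by rw [hμ']; infer_instance
  have hμv : μ ≪ volume := Measure.absolutelyContinuous_of_le Measure.restrict_le_self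
  have hiter : ∀ {f w : ℝ × ℝ → ℝ} {K L : NNReal}, LipschitzWith K f → Measurable w →
      (∀ p, |w p| ≤ L) → ∀ h : ℝ, ∫ p, h⁻¹ * (f (p.1 + h, p.2) - f p) * w p ∂μ =
        ∫ r in x..y, ∫ θ in α..β, h⁻¹ * (f (r + h, θ) - f (r, θ)) * w (r, θ) := by
    intro f w K L hf hw hwL h
    have hi : Integrable (fun p : ℝ × ℝ => h⁻¹ * (f (p.1 + h, p.2) - f p) * w p) μ := by
      refine Integrable.of_bound (hmeas hf.continuous hw h).aestronglyMeasurable (K * L)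
        (Eventually.of_forall fun p => ?_)
      rw [norm_mul]
      exact mul_le_mul (hf.abs_diffQuot_fst_le p h) (hwL _) (abs_nonneg _) K.2
    rw [hμ'] at hi ⊢
    rw [integral_prod _ hi]
    simp only [intervalIntegral.integral_of_le hxy, intervalIntegral.integral_of_le hαβ]
  have hneg : Tendsto (fun h : ℝ => -h) (𝓝[≠] 0) (𝓝[≠] 0) := by
    refine tendsto_nhdsWithin_iff.2 ⟨?_, ?_⟩
    · simpa using (continuous_neg.tendsto (0 : ℝ)).mono_left nhdsWithin_le_nhds
    · filter_upwards [self_mem_nhdsWithin] with h hh using neg_ne_zero.2 hh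
  have hlimG := (tendsto_integral_diffQuot_fst_mul hu hVm hVL hμv).comp hneg
  have hlimH := tendsto_integral_diffQuot_fst_mul hv hUm hUK hμv
  have hshift : Tendsto (fun h => (∫ r in x..y, G (-h) (r + h)) - ∫ r in x..y, G (-h) r)
      (𝓝[≠] 0) (𝓝 0) := by
    refine squeeze_zero_norm (a := fun h => 2 * (K * L * (β - α)) * |h|) (fun h => ?_) ?_
    · rw [intervalIntegral.integral_comp_add_right (G (-h)),
        intervalIntegral.integral_interval_sub_interval_comm (hGi _ _ _) (hGi _ _ _) (hGi _ _ _)]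
      have hb : ∀ s t, ‖∫ r in s..t, G (-h) r‖ ≤ K * L * (β - α) * |t - s| := fun s t =>
        intervalIntegral.norm_integral_le_of_norm_le_const fun r _ => hGb _ r
      have h1 := hb (x + h) x
      have h2 := hb (y + h) y
      simp only [sub_add_cancel_left, abs_neg] at h1 h2
      exact (_root_.norm_sub_le _ _).trans (by linarith)
    · have : Tendsto (fun h : ℝ => 2 * (K * L * (β - α)) * |h|) (𝓝 0)
          (𝓝 (2 * (K * L * (β - α)) * |(0 : ℝ)|)) := Continuous.tendsto (by fun_prop) 0
      simpa using this.mono_left nhdsWithin_le_nhds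
  have hlim := (hshift.add hlimG).sub hlimH
  rw [zero_add] at hlim
  have hD := tendsto_inv_mul_integral_comp_add_sub hac x y
  have huniq := tendsto_nhds_unique_of_eventuallyEq hlim hD (by
    filter_upwards [self_mem_nhdsWithin] with h hh
    rw [← intervalIntegral.integral_const_mul]
    simp only [hquot h hh, Function.comp_apply]
    rw [hiter hu hVm hVL, hiter hv hUm hUK, intervalIntegral.integral_sub _ (hHi h x y)]
    · simp only [hG, hH]; ring
    · simpa using (hGi (-h) (x + h) (y + h)).comp_add_right h)
  have hdu : ∀ᵐ p ∂μ, U p = fderiv ℝ u p (0, 1) ∧ V p = fderiv ℝ v p (0, 1) := by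
    filter_upwards [hμv.ae_le hu.ae_differentiableAt, hμv.ae_le hv.ae_differentiableAt]
      with p hp hp'
    have hl : HasDerivAt (fun s => (p.1, s)) ((0 : ℝ), (1 : ℝ)) p.2 :=
      (hasDerivAt_const p.2 p.1).prodMk (hasDerivAt_id p.2)
    exact ⟨(HasFDerivAt.comp_hasDerivAt (f := fun s => (p.1, s)) (x := p.2)
      hp.hasFDerivAt hl).deriv, (HasFDerivAt.comp_hasDerivAt (f := fun s => (p.1, s)) (x := p.2)
      hp'.hasFDerivAt hl).deriv⟩
  have hint : ∀ {f w : ℝ × ℝ → ℝ} {K L : NNReal}, LipschitzWith K f → Measurable w →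
      (∀ p, |w p| ≤ L) → Integrable (fun p => fderiv ℝ f p (1, 0) * w p) μ := by
    intro f w K L hf hw hwL
    refine Integrable.of_bound ((measurable_fderiv_apply_const ℝ f _).mul hw).aestronglyMeasurable
      (K * L) (Eventually.of_forall fun p => ?_)
    rw [norm_mul]
    refine mul_le_mul ?_ (hwL p) (abs_nonneg _) K.2
    refine ((fderiv ℝ f p).le_opNorm _).trans ?_
    simpa using norm_fderiv_le_of_lipschitz ℝ hf
  rw [← huniq, ← integral_sub (hint hu hVm hVL) (hint hv hUm hUK)]
  refine integral_congr_ae ?_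
  filter_upwards [hdu] with p hp
  rw [hp.1, hp.2]
  ring

theorem LinearMap.det_prod_self (A : ℝ × ℝ →ₗ[ℝ] ℝ × ℝ) :
    LinearMap.det A = (A (1, 0)).1 * (A (0, 1)).2 - (A (0, 1)).1 * (A (1, 0)).2 := by
  rw [← LinearMap.det_toMatrix (Module.Basis.finTwoProd ℝ), Matrix.det_fin_two]
  simp [LinearMap.toMatrix_apply]

theorem DifferentiableAt.of_comp_polarCoord_symm {Γ : ℝ × ℝ → ℝ × ℝ} {p : ℝ × ℝ}
    (hp : p ∈ polarCoord.target) (h : DifferentiableAt ℝ (Γ ∘ polarCoord.symm) p) :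
    DifferentiableAt ℝ Γ (polarCoord.symm p) := by
  have hdet : (fderivPolarCoordSymm p).det ≠ 0 := by
    rw [det_fderivPolarCoordSymm]
    exact ne_of_gt hp.1
  have hs : polarCoord.symm p ∈ polarCoord.source := polarCoord.map_target hp
  have hinv : DifferentiableAt ℝ polarCoord (polarCoord.symm p) :=
    (polarCoord.symm.hasFDerivAt_symm (a := polarCoord.symm p)
      (f' := (fderivPolarCoordSymm p).toContinuousLinearEquivOfDetNeZero hdet) hs
      (by
        rw [OpenPartialHomeomorph.symm_symm, polarCoord.right_inv hp]
        exact hasFDerivAt_polarCoord_symm p)).differentiableAt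
  have hcomp : DifferentiableAt ℝ ((Γ ∘ polarCoord.symm) ∘ polarCoord) (polarCoord.symm p) := by
    refine DifferentiableAt.comp _ ?_ hinv
    rwa [polarCoord.right_inv hp]
  refine hcomp.congr_of_eventuallyEq ?_
  filter_upwards [polarCoord.eventually_left_inverse hs] with q hq
  simp only [Function.comp_apply, hq]

theorem det_fderiv_comp_polarCoord_symm {Γ : ℝ × ℝ → ℝ × ℝ} {p : ℝ × ℝ}
    (hp : p ∈ polarCoord.target) (h : DifferentiableAt ℝ (Γ ∘ polarCoord.symm) p) :
    LinearMap.det (fderiv ℝ (Γ ∘ polarCoord.symm) p).toLinearMap =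
      p.1 * LinearMap.det (fderiv ℝ Γ (polarCoord.symm p)).toLinearMap := by
  have hΓ := DifferentiableAt.of_comp_polarCoord_symm hp h
  rw [(hΓ.hasFDerivAt.comp p (hasFDerivAt_polarCoord_symm p)).fderiv, ← det_fderivPolarCoordSymm p,
    ContinuousLinearMap.toLinearMap_comp, LinearMap.det_comp, mul_comm]

/-- Polar coordinates with the radius clamped to `[0, 1]`. -/
noncomputable def clampedPolar (p : ℝ × ℝ) : ℝ × ℝ :=
  polarCoord.symm (projIcc 0 1 zero_le_one p.1, p.2)

theorem clampedPolar_mem_disc (p : ℝ × ℝ) :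
    (clampedPolar p).1 ^ 2 + (clampedPolar p).2 ^ 2 ≤ 1 := by
  have h := (projIcc (0 : ℝ) 1 zero_le_one p.1).2
  simp only [clampedPolar, polarCoord_symm_apply]
  rw [mul_pow, mul_pow, ← mul_add, Real.cos_sq_add_sin_sq, mul_one]
  exact pow_le_one₀ h.1 h.2

theorem clampedPolar_of_mem {r : ℝ} (hr : r ∈ Icc (0 : ℝ) 1) (θ : ℝ) :
    clampedPolar (r, θ) = (r * Real.cos θ, r * Real.sin θ) := by
  simp [clampedPolar, projIcc_of_mem zero_le_one hr]

theorem lipschitzWith_clampedPolar : LipschitzWith 2 clampedPolar := by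
  have key : ∀ (f : ℝ → ℝ), (∀ x, |f x| ≤ 1) → (∀ x y, |f x - f y| ≤ |x - y|) → ∀ p q : ℝ × ℝ,
      |projIcc (0 : ℝ) 1 zero_le_one p.1 * f p.2 - projIcc (0 : ℝ) 1 zero_le_one q.1 * f q.2| ≤
        2 * dist p q := by
    intro f hf hf' p q
    have h1 : |(projIcc (0 : ℝ) 1 zero_le_one p.1 : ℝ) - projIcc (0 : ℝ) 1 zero_le_one q.1| ≤
        dist p q := by
      have := (LipschitzWith.projIcc (zero_le_one (α := ℝ))).dist_le_mul p.1 q.1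
      rw [NNReal.coe_one, one_mul, Subtype.dist_eq, Real.dist_eq] at this
      exact this.trans (by rw [Prod.dist_eq]; exact le_max_left _ _)
    have h2 : |p.2 - q.2| ≤ dist p q := by rw [Prod.dist_eq, ← Real.dist_eq]; exact le_max_right _ _
    have hq := (projIcc (0 : ℝ) 1 zero_le_one q.1).2
    set c : ℝ := (↑(projIcc (0 : ℝ) 1 zero_le_one p.1) : ℝ)
    set d : ℝ := (↑(projIcc (0 : ℝ) 1 zero_le_one q.1) : ℝ)
    calc |c * f p.2 - d * f q.2| = |(c - d) * f p.2 + d * (f p.2 - f q.2)| := by ring_nf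
      _ ≤ |c - d| * |f p.2| + |d| * |f p.2 - f q.2| := by
        rw [← abs_mul, ← abs_mul]; exact abs_add_le _ _
      _ ≤ dist p q * 1 + 1 * dist p q := by
        gcongr
        · exact hf _
        · exact abs_le.2 ⟨by linarith [hq.1], hq.2⟩
        · exact (hf' _ _).trans h2
      _ = 2 * dist p q := by ring
  refine LipschitzWith.of_dist_le_mul fun p q => ?_
  rw [Prod.dist_eq]
  simp only [clampedPolar, polarCoord_symm_apply, Real.dist_eq, NNReal.coe_ofNat]
  refine max_le (key Real.cos Real.abs_cos_le_one ?_ p q) (key Real.sin Real.abs_sin_le_one ?_ p q)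
  · intro x y; simpa [Real.dist_eq] using Real.lipschitzWith_cos.dist_le_mul x y
  · intro x y; simpa [Real.dist_eq] using Real.lipschitzWith_sin.dist_le_mul x y

theorem LipschitzOnWith.integral_det_disc {Γ : ℝ × ℝ → ℝ × ℝ} {K : NNReal}
    (hΓ : LipschitzOnWith K Γ {p : ℝ × ℝ | p.1 ^ 2 + p.2 ^ 2 ≤ 1}) :
    ∫ x in {p : ℝ × ℝ | p.1 ^ 2 + p.2 ^ 2 < 1}, LinearMap.det (fderiv ℝ Γ x).toLinearMap =
      ∫ θ in -Real.pi..Real.pi, (Γ (Real.cos θ, Real.sin θ)).1 *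
        deriv (fun s => (Γ (Real.cos s, Real.sin s)).2) θ := by
  set Φ : ℝ × ℝ → ℝ × ℝ := fun p => Γ (clampedPolar p) with hΦ
  have hΦl : LipschitzWith (K * 2) Φ := by
    rw [← lipschitzOnWith_univ]
    exact hΓ.comp lipschitzWith_clampedPolar.lipschitzOnWith fun p _ => clampedPolar_mem_disc p
  have hu : LipschitzWith (K * 2) fun p => (Φ p).1 := by
    simpa [Function.comp_def] using LipschitzWith.prod_fst.comp hΦl
  have hv : LipschitzWith (K * 2) fun p => (Φ p).2 := by
    simpa [Function.comp_def] using LipschitzWith.prod_snd.comp hΦl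
  have hper : ∀ r, Φ (r, -Real.pi) = Φ (r, Real.pi) := fun r => by
    simp [hΦ, clampedPolar]
  have hrect := hu.integral_det_rectangle hv zero_le_one
    (neg_le_self Real.pi_pos.le) (fun r => by rw [hper]) (fun r => by rw [hper])
  simp only [hΦ, clampedPolar_of_mem (left_mem_Icc.2 zero_le_one),
    clampedPolar_of_mem (right_mem_Icc.2 zero_le_one), one_mul, zero_mul, deriv_const, mul_zero,
    intervalIntegral.integral_zero, sub_zero] at hrect
  rw [← hrect]
  have hmeas : MeasurableSet {p : ℝ × ℝ | p.1 ^ 2 + p.2 ^ 2 < 1} :=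
    measurableSet_lt (by fun_prop) measurable_const
  have hset : polarCoord.target ∩ polarCoord.symm ⁻¹' {p : ℝ × ℝ | p.1 ^ 2 + p.2 ^ 2 < 1} =
      Ioo 0 1 ×ˢ Ioo (-Real.pi) Real.pi := by
    ext ⟨r, θ⟩
    have : (r * Real.cos θ) ^ 2 + (r * Real.sin θ) ^ 2 = r ^ 2 := by
      rw [mul_pow, mul_pow, ← mul_add, Real.cos_sq_add_sin_sq, mul_one]
    simp only [polarCoord_target, mem_inter_iff, mem_prod, mem_Ioi, mem_preimage,
      polarCoord_symm_apply, mem_ofPred_eq, this, mem_Ioo]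
    constructor
    · rintro ⟨⟨h1, h2⟩, h3⟩
      exact ⟨⟨h1, (sq_lt_one_iff₀ h1.le).1 h3⟩, h2⟩
    · rintro ⟨⟨h1, h2⟩, h3⟩
      exact ⟨⟨h1, h3⟩, (sq_lt_one_iff₀ h1.le).2 h2⟩
  have hae : (Ioo 0 1 ×ˢ Ioo (-Real.pi) Real.pi : Set (ℝ × ℝ)) =ᵐ[volume]
      (Ioc 0 1 ×ˢ Ioc (-Real.pi) Real.pi : Set (ℝ × ℝ)) :=
    Measure.set_prod_ae_eq Ioo_ae_eq_Ioc Ioo_ae_eq_Ioc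
  rw [← setIntegral_congr_set hae, ← integral_indicator hmeas, ← integral_comp_polarCoord_symm]
  have hind : ∀ p : ℝ × ℝ, p.1 • ({p : ℝ × ℝ | p.1 ^ 2 + p.2 ^ 2 < 1}.indicator
      (fun x => LinearMap.det (fderiv ℝ Γ x).toLinearMap) (polarCoord.symm p)) =
      (polarCoord.symm ⁻¹' {p : ℝ × ℝ | p.1 ^ 2 + p.2 ^ 2 < 1}).indicator
        (fun p => p.1 * LinearMap.det (fderiv ℝ Γ (polarCoord.symm p)).toLinearMap) p := by
    intro p
    by_cases hp : polarCoord.symm p ∈ {p : ℝ × ℝ | p.1 ^ 2 + p.2 ^ 2 < 1}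
    · rw [indicator_of_mem hp, indicator_of_mem (mem_preimage.2 hp), smul_eq_mul]
    · rw [indicator_of_notMem hp, indicator_of_notMem (mem_preimage.not.2 hp), smul_zero]
  simp only [hind]
  rw [setIntegral_indicator (continuous_polarCoord_symm.measurable hmeas), hset]
  refine setIntegral_congr_ae (measurableSet_Ioo.prod measurableSet_Ioo) ?_
  filter_upwards [hΦl.ae_differentiableAt] with p hp hpm
  have hev : Γ ∘ polarCoord.symm =ᶠ[𝓝 p] Φ := by
    filter_upwards [(isOpen_Ioo.prod isOpen_Ioo).mem_nhds hpm] with q hq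
    have hq1 : q.1 ∈ Icc (0 : ℝ) 1 := Ioo_subset_Icc_self hq.1
    simp [hΦ, clampedPolar, projIcc_of_mem zero_le_one hq1]
  have hpt : p ∈ polarCoord.target := ⟨hpm.1.1, hpm.2⟩
  have hu' := (hp.hasFDerivAt.fst).fderiv
  have hv' := (hp.hasFDerivAt.snd).fderiv
  rw [← det_fderiv_comp_polarCoord_symm hpt (hp.congr_of_eventuallyEq hev), hev.fderiv_eq,
    LinearMap.det_prod_self]
  simp only [hΦ] at hu' hv'
  rw [hu', hv']
  rfl

/-- Lipschitz Stokes theorem for the form `x dy`: if `Γ` is a Lipschitz extension to the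
closed unit disc of a closed Lipschitz curve `γ : [0,1] → ℝ²` (via the boundary
parametrization `t ↦ (cos 2πt, sin 2πt)`), then the oriented enclosed area of `γ`
equals the integral of `det DΓ` over the open unit disc. -/
theorem stmt_8 (γ : ℝ → ℝ × ℝ) (Kγ KΓ : NNReal) (Γ : ℝ × ℝ → ℝ × ℝ)
    (hγ : LipschitzOnWith Kγ γ (Icc 0 1)) (hclosed : γ 0 = γ 1)
    (hΓ : LipschitzOnWith KΓ Γ {p : ℝ × ℝ | p.1 ^ 2 + p.2 ^ 2 ≤ 1})
    (hbd : ∀ t ∈ Icc (0:ℝ) 1,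
      γ t = Γ (Real.cos (2 * Real.pi * t), Real.sin (2 * Real.pi * t))) :
    ∫ t in (0:ℝ)..1, (γ t).1 * deriv (fun s => (γ s).2) t
      = ∫ x in {p : ℝ × ℝ | p.1 ^ 2 + p.2 ^ 2 < 1},
          LinearMap.det (fderiv ℝ Γ x).toLinearMap := by
  rw [hΓ.integral_det_disc]
  set f : ℝ → ℝ × ℝ := fun θ => Γ (Real.cos θ, Real.sin θ) with hf
  set F : ℝ → ℝ := fun θ => (f θ).1 * deriv (fun s => (f s).2) θ with hF
  have hfp : Function.Periodic f (2 * Real.pi) := fun θ => by simp [hf]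
  have hFp : Function.Periodic F (2 * Real.pi) := fun θ => by
    simp only [hF]
    rw [hfp, ← deriv_comp_add_const]
    simp only [hfp _]
  have hshift := hFp.intervalIntegral_add_eq (-Real.pi) 0
  rw [show -Real.pi + 2 * Real.pi = Real.pi by ring, zero_add] at hshift
  have hscale := intervalIntegral.smul_integral_comp_mul_left (a := 0) (b := 1) F (2 * Real.pi)
  rw [mul_zero, mul_one] at hscale
  rw [hshift, ← hscale, smul_eq_mul, ← intervalIntegral.integral_const_mul]
  refine intervalIntegral.integral_congr_ae ?_
  filter_upwards [(measure_singleton (1 : ℝ) : volume {(1 : ℝ)} = 0) |> measure_eq_zero_iff_ae_notMem.1]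
    with t ht1 ht
  rw [uIoc_of_le zero_le_one] at ht
  have hto : t ∈ Ioo (0 : ℝ) 1 := ⟨ht.1, lt_of_le_of_ne ht.2 ht1⟩
  have hev : (fun s => (γ s).2) =ᶠ[𝓝 t] fun s => (f (2 * Real.pi * s)).2 := by
    filter_upwards [isOpen_Ioo.mem_nhds hto] with s hs
    rw [hbd s (Ioo_subset_Icc_self hs)]
  rw [hev.deriv_eq, deriv_comp_mul_left (2 * Real.pi) (fun s => (f s).2) t,
    hbd t (Ioo_subset_Icc_self hto)]
  simp only [hF, smul_eq_mul]
  ring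
end

section
/- Let f : Q₀ = [0,1]^{n+m} → X be Lipschitz into a metric space, n ≥ 1, m ≥ 0, and E ⊆ Q₀ measurable. Then H^{n,m}_∞(f,E) ≲_{n,m} ∫_E Θⁿ_*(f,x) dH^{n+m}(x), where the implied constant depends only on n and m. -/
open Set MeasureTheory Filter

/-- Hausdorff content `H^n_∞` (with the standard normalization `ω_n (diam/2)^n`). -/
noncomputable def hContent {X : Type*} [EMetricSpace X] (n : ℕ) (E : Set X) : ENNReal :=
  ⨅ (A : ℕ → Set X) (_ : E ⊆ ⋃ i, A i),
    ∑' i, volume (Metric.ball (0 : EuclideanSpace ℝ (Fin n)) 1) / 2 ^ n *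
      (EMetric.diam (A i)) ^ n

/-- A closed dyadic cube in ℝ^d: `2^{-k}([0,1]^d + v)` with `k ∈ ℤ`, `v ∈ ℤ^d`. -/
def IsDyadicCube {d : ℕ} (Q : Set (EuclideanSpace ℝ (Fin d))) : Prop :=
  ∃ (k : ℤ) (v : Fin d → ℤ),
    Q = {x | ∀ i, (v i : ℝ) / 2 ^ k ≤ x i ∧ x i ≤ ((v i : ℝ) + 1) / 2 ^ k}

/-- The unit cube `[0,1]^d`. -/
def unitCube (d : ℕ) : Set (EuclideanSpace ℝ (Fin d)) := {x | ∀ i, x i ∈ Icc (0:ℝ) 1}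

/-- The dyadic mapping content `H^{n,m}_∞(f,E)`: infimum of
`∑ H^n_∞(f(Qᵢ)) (diam Qᵢ)^m` over coverings `E ⊆ ⋃ᵢ Qᵢ ⊆ Q₀` by closed dyadic cubes. -/
noncomputable def dyadicMapContent {X : Type*} [EMetricSpace X]
    (n m d : ℕ) (Q₀ : Set (EuclideanSpace ℝ (Fin d)))
    (f : EuclideanSpace ℝ (Fin d) → X) (E : Set (EuclideanSpace ℝ (Fin d))) : ENNReal :=
  ⨅ (Q : ℕ → Set (EuclideanSpace ℝ (Fin d))) (_ : ∀ i, IsDyadicCube (Q i))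
    (_ : E ⊆ ⋃ i, Q i) (_ : ∀ i, Q i ⊆ Q₀),
    ∑' i, hContent n (f '' Q i) * (EMetric.diam (Q i)) ^ m

/-- The lower `n`-density `Θⁿ_*(f,x) = liminf_{r→0⁺} H^n_∞(f(B(x,r)))/(ω_n rⁿ)`. -/
noncomputable def lowerDensity {X : Type*} [MetricSpace X] (n : ℕ) {d : ℕ}
    (f : EuclideanSpace ℝ (Fin d) → X) (x : EuclideanSpace ℝ (Fin d)) : ENNReal :=
  liminf (fun r : ℝ => hContent n (f '' Metric.ball x r) /
      (volume (Metric.ball (0 : EuclideanSpace ℝ (Fin n)) 1) * ENNReal.ofReal (r ^ n)))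
    (nhdsWithin 0 (Ioi 0))

/-- The multi-index of a generation-`k` dyadic cube containing `x`. Faces belong to the cube above
them, except that the faces `x i = 1` of the unit cube belong to the last cube inside it. -/
noncomputable def dyadicIndex {d : ℕ} (k : ℕ) (x : EuclideanSpace ℝ (Fin d)) : Fin d → ℤ :=
  fun i => min ⌊(2 : ℝ) ^ k * x i⌋ (2 ^ k - 1)

/-- The closed dyadic cube of generation `k` and multi-index `v`. -/
def dyadicBox {d : ℕ} (k : ℕ) (v : Fin d → ℤ) : Set (EuclideanSpace ℝ (Fin d)) :=
  {x | ∀ i, (v i : ℝ) / 2 ^ k ≤ x i ∧ x i ≤ ((v i : ℝ) + 1) / 2 ^ k}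

/-- The points of the unit cube whose generation-`k` multi-index is `v`. -/
def dyadicCell {d : ℕ} (k : ℕ) (v : Fin d → ℤ) : Set (EuclideanSpace ℝ (Fin d)) :=
  {x | x ∈ unitCube d ∧ dyadicIndex k x = v}

lemma isDyadicCube_dyadicBox {d : ℕ} (k : ℕ) (v : Fin d → ℤ) : IsDyadicCube (dyadicBox k v) :=
  ⟨k, v, by simp only [dyadicBox, zpow_natCast]⟩

lemma dyadicIndex_eq_succ_div_two {d : ℕ} (k : ℕ) (x : EuclideanSpace ℝ (Fin d)) (i : Fin d) :
    dyadicIndex k x i = dyadicIndex (k + 1) x i / 2 := by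
  simp only [dyadicIndex]
  have h1 := Int.floor_le ((2 : ℝ) ^ k * x i)
  have h2 := Int.lt_floor_add_one ((2 : ℝ) ^ k * x i)
  have h3 : 2 * ⌊(2 : ℝ) ^ k * x i⌋ ≤ ⌊(2 : ℝ) ^ (k + 1) * x i⌋ := by
    rw [Int.le_floor]; push_cast; rw [pow_succ]; linarith
  have h4 : ⌊(2 : ℝ) ^ (k + 1) * x i⌋ < 2 * ⌊(2 : ℝ) ^ k * x i⌋ + 2 := by
    rw [Int.floor_lt]; push_cast; rw [pow_succ]; linarith
  have := pow_succ (2 : ℤ) k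
  omega

lemma dyadicIndex_eq_of_le {d : ℕ} {k l : ℕ} (hkl : k ≤ l) {x y : EuclideanSpace ℝ (Fin d)}
    (h : dyadicIndex l x = dyadicIndex l y) : dyadicIndex k x = dyadicIndex k y := by
  induction l, hkl using Nat.le_induction with
  | base => exact h
  | succ l _ ih =>
    exact ih (funext fun i => by
      rw [dyadicIndex_eq_succ_div_two l x, dyadicIndex_eq_succ_div_two l y, h])

lemma dyadicIndex_nonneg {d : ℕ} (k : ℕ) {x : EuclideanSpace ℝ (Fin d)} (hx : x ∈ unitCube d)
    (i : Fin d) : 0 ≤ dyadicIndex k x i := by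
  have h1 : (0 : ℤ) ≤ ⌊(2 : ℝ) ^ k * x i⌋ :=
    Int.floor_nonneg.2 (mul_nonneg (by positivity) (hx i).1)
  have h2 : (1 : ℤ) ≤ 2 ^ k := one_le_pow₀ (by norm_num)
  simp only [dyadicIndex]
  omega

lemma dyadicIndex_add_one_le {d : ℕ} (k : ℕ) (x : EuclideanSpace ℝ (Fin d)) (i : Fin d) :
    dyadicIndex k x i + 1 ≤ 2 ^ k := by
  simp only [dyadicIndex]
  omega

lemma mem_dyadicBox_dyadicIndex {d : ℕ} (k : ℕ) {x : EuclideanSpace ℝ (Fin d)}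
    (hx : x ∈ unitCube d) : x ∈ dyadicBox k (dyadicIndex k x) := by
  intro i
  have hP : (0 : ℝ) < 2 ^ k := by positivity
  have h1 := Int.floor_le ((2 : ℝ) ^ k * x i)
  have h2 := Int.lt_floor_add_one ((2 : ℝ) ^ k * x i)
  rw [div_le_iff₀ hP, le_div_iff₀ hP]
  simp only [dyadicIndex, Int.cast_min]
  push_cast
  constructor
  · exact (min_le_left _ _).trans (by linarith)
  · rw [← min_add_add_right, le_min_iff]
    constructor
    · linarith
    · nlinarith [(hx i).2]

lemma dyadicBox_subset_unitCube {d : ℕ} {k : ℕ} {v : Fin d → ℤ} (h0 : ∀ i, 0 ≤ v i)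
    (h1 : ∀ i, v i + 1 ≤ 2 ^ k) : dyadicBox k v ⊆ unitCube d := by
  intro x hx i
  have hP : (0 : ℝ) < 2 ^ k := by positivity
  have h0' : (0 : ℝ) ≤ v i := by exact_mod_cast h0 i
  have h1' : (v i : ℝ) + 1 ≤ 2 ^ k := by exact_mod_cast h1 i
  exact ⟨(by positivity : (0 : ℝ) ≤ v i / 2 ^ k).trans (hx i).1,
    (hx i).2.trans ((div_le_one hP).2 h1')⟩

lemma dyadicBox_dyadicIndex_subset_unitCube {d : ℕ} (k : ℕ) {x : EuclideanSpace ℝ (Fin d)}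
    (hx : x ∈ unitCube d) : dyadicBox k (dyadicIndex k x) ⊆ unitCube d :=
  dyadicBox_subset_unitCube (dyadicIndex_nonneg k hx) (dyadicIndex_add_one_le k x)

lemma dyadicCell_subset_dyadicBox {d : ℕ} (k : ℕ) (v : Fin d → ℤ) :
    dyadicCell k v ⊆ dyadicBox k v := by
  rintro x ⟨hx, rfl⟩
  exact mem_dyadicBox_dyadicIndex k hx

lemma dist_le_of_mem_dyadicBox {d : ℕ} {k : ℕ} {v : Fin d → ℤ} {x y : EuclideanSpace ℝ (Fin d)}
    (hx : x ∈ dyadicBox k v) (hy : y ∈ dyadicBox k v) : dist x y ≤ d / 2 ^ k := by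
  rw [EuclideanSpace.dist_eq]
  refine Real.sqrt_le_iff.2 ⟨by positivity, ?_⟩
  have hi : ∀ i ∈ Finset.univ, dist (x i) (y i) ^ 2 ≤ (1 / 2 ^ k : ℝ) ^ 2 := fun i _ => by
    refine pow_le_pow_left₀ dist_nonneg ?_ 2
    have := (hx i).1; have := (hx i).2; have := (hy i).1; have := (hy i).2
    rw [add_div] at *
    rw [Real.dist_eq, abs_le]
    constructor <;> linarith
  refine (Finset.sum_le_card_nsmul _ _ _ hi).trans ?_
  have hd : (d : ℝ) ≤ (d : ℝ) ^ 2 := by exact_mod_cast Nat.le_self_pow two_ne_zero d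
  simp only [Finset.card_univ, Fintype.card_fin, nsmul_eq_mul, div_pow, one_pow, mul_one_div]
  gcongr

lemma ediam_dyadicBox_le {d : ℕ} (k : ℕ) (v : Fin d → ℤ) :
    Metric.ediam (dyadicBox k v) ≤ d * (2 ^ k)⁻¹ := by
  refine (Metric.ediam_le_of_forall_dist_le
    fun x hx y hy => dist_le_of_mem_dyadicBox hx hy).trans_eq ?_
  rw [ENNReal.ofReal_div_of_pos (by positivity), ENNReal.ofReal_natCast,
    ENNReal.ofReal_pow (by norm_num), div_eq_mul_inv]
  norm_num

lemma measurable_dyadicIndex {d : ℕ} (k : ℕ) :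
    Measurable (dyadicIndex k : EuclideanSpace ℝ (Fin d) → Fin d → ℤ) := by
  refine measurable_pi_lambda _ fun i => Measurable.min ?_ measurable_const
  exact Int.measurable_floor.comp (by fun_prop)

lemma measurableSet_unitCube (d : ℕ) : MeasurableSet (unitCube d) := by
  have : unitCube d = ⋂ i, {x | x i ∈ Icc (0 : ℝ) 1} := by ext; simp [unitCube]
  rw [this]
  exact MeasurableSet.iInter fun i => measurableSet_Icc.preimage (by fun_prop)

lemma measurableSet_dyadicCell {d : ℕ} (k : ℕ) (v : Fin d → ℤ) :
    MeasurableSet (dyadicCell k v) :=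
  (measurableSet_unitCube d).inter (measurable_dyadicIndex k (measurableSet_singleton v))

lemma le_volume_dyadicCell {d : ℕ} {k : ℕ} {v : Fin d → ℤ} (h0 : ∀ i, 0 ≤ v i)
    (h1 : ∀ i, v i + 1 ≤ 2 ^ k) : ((2 : ENNReal) ^ k)⁻¹ ^ d ≤ volume (dyadicCell k v) := by
  have hP : (0 : ℝ) < 2 ^ k := by positivity
  have hsub : (WithLp.ofLp : EuclideanSpace ℝ (Fin d) → Fin d → ℝ) ⁻¹'
      (univ.pi fun i => Ico ((v i : ℝ) / 2 ^ k) (((v i : ℝ) + 1) / 2 ^ k)) ⊆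
      dyadicCell k v := by
    intro x hx
    have hx' : ∀ i, (v i : ℝ) / 2 ^ k ≤ x i ∧ x i < ((v i : ℝ) + 1) / 2 ^ k :=
      fun i => hx i (mem_univ i)
    refine ⟨dyadicBox_subset_unitCube h0 h1 fun i => ⟨(hx' i).1, (hx' i).2.le⟩, funext fun i => ?_⟩
    have hf : ⌊(2 : ℝ) ^ k * x i⌋ = v i := by
      have := hx' i
      rw [div_le_iff₀ hP, lt_div_iff₀ hP] at this
      rw [Int.floor_eq_iff]
      constructor <;> linarith
    simp only [dyadicIndex, hf]
    have := h1 i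
    omega
  refine le_trans (le_of_eq ?_) (measure_mono hsub)
  rw [(PiLp.volume_preserving_ofLp (Fin d)).measure_preimage
    (MeasurableSet.univ_pi fun i => measurableSet_Ico).nullMeasurableSet, Real.volume_pi_Ico]
  have hi : ∀ i, ENNReal.ofReal (((v i : ℝ) + 1) / 2 ^ k - (v i : ℝ) / 2 ^ k) =
      ((2 : ENNReal) ^ k)⁻¹ := fun i => by
    rw [← sub_div, add_sub_cancel_left, one_div, ENNReal.ofReal_inv_of_pos hP,
      ENNReal.ofReal_pow (by norm_num)]
    norm_num
  simp [hi]

lemma hContent_mono {X : Type*} [EMetricSpace X] (n : ℕ) {E F : Set X} (h : E ⊆ F) :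
    hContent n E ≤ hContent n F :=
  le_iInf₂ fun A hA => iInf₂_le A (h.trans hA)

lemma hContent_le_ediam_pow {X : Type*} [EMetricSpace X] {n : ℕ} (hn : n ≠ 0) (E : Set X) :
    hContent n E ≤
      volume (Metric.ball (0 : EuclideanSpace ℝ (Fin n)) 1) / 2 ^ n * Metric.ediam E ^ n := by
  refine (iInf₂_le (fun i : ℕ => if i = 0 then E else ∅)
    (fun x hx => mem_iUnion.2 ⟨0, by simpa using hx⟩)).trans_eq ?_
  change ∑' i : ℕ, volume (Metric.ball (0 : EuclideanSpace ℝ (Fin n)) 1) / 2 ^ n *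
    Metric.ediam (if i = 0 then E else ∅) ^ n = _
  rw [tsum_eq_single 0 fun i hi => by simp [hi, hn]]
  simp

lemma ediam_image_le_of_lipschitzOnWith {α β : Type*} [PseudoEMetricSpace α]
    [PseudoEMetricSpace β] {K : NNReal} {f : α → β} {s t : Set α} (hf : LipschitzOnWith K f s)
    (hts : t ⊆ s) : Metric.ediam (f '' t) ≤ K * Metric.ediam t := by
  refine Metric.ediam_image_le_iff.2 fun x hx y hy => (hf (hts hx) (hts hy)).trans ?_
  gcongr
  exact Metric.edist_le_ediam_of_mem hx hy

lemma hContent_image_dyadicBox_le {X : Type*} [EMetricSpace X] {n d : ℕ} (hn : n ≠ 0)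
    {K : NNReal} {f : EuclideanSpace ℝ (Fin d) → X} (hf : LipschitzOnWith K f (unitCube d))
    {k : ℕ} {v : Fin d → ℤ} (hv : dyadicBox k v ⊆ unitCube d) :
    hContent n (f '' dyadicBox k v) ≤
      volume (Metric.ball (0 : EuclideanSpace ℝ (Fin n)) 1) / 2 ^ n * (K * d) ^ n *
        (2 ^ k)⁻¹ ^ n := by
  refine (hContent_le_ediam_pow hn _).trans ?_
  rw [mul_assoc _ ((K * d : ENNReal) ^ n), ← mul_pow, mul_assoc (K : ENNReal)]
  gcongr
  refine (ediam_image_le_of_lipschitzOnWith hf hv).trans ?_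
  gcongr
  exact ediam_dyadicBox_le k v

lemma volume_unitBall_ne_zero (n : ℕ) :
    volume (Metric.ball (0 : EuclideanSpace ℝ (Fin n)) 1) ≠ 0 :=
  (Metric.measure_ball_pos volume _ one_pos).ne'

lemma volume_unitBall_ne_top (n : ℕ) :
    volume (Metric.ball (0 : EuclideanSpace ℝ (Fin n)) 1) ≠ ⊤ :=
  measure_ball_lt_top.ne

lemma exists_dyadicBox_content_lt {X : Type*} [EMetricSpace X] {n d : ℕ} (m : ℕ) (hn : n ≠ 0)
    {K : NNReal} {f : EuclideanSpace ℝ (Fin d) → X} (hf : LipschitzOnWith K f (unitCube d))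
    {δ : ENNReal} (hδ : 0 < δ) :
    ∃ k : ℕ, hContent n (f '' dyadicBox k 0) * Metric.ediam (dyadicBox k (0 : Fin d → ℤ)) ^ m
      < δ := by
  have hv : ∀ k, dyadicBox k (0 : Fin d → ℤ) ⊆ unitCube d := fun k =>
    dyadicBox_subset_unitCube (fun _ => le_rfl) fun _ => by
      simpa using one_le_pow₀ (a := (2 : ℤ)) (by norm_num)
  set c : ENNReal := volume (Metric.ball (0 : EuclideanSpace ℝ (Fin n)) 1) / 2 ^ n * (K * d) ^ n
    * d ^ m with hc
  have hc_top : c ≠ ⊤ := by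
    refine ENNReal.mul_ne_top (ENNReal.mul_ne_top ?_ (by finiteness)) (by finiteness)
    exact ENNReal.div_ne_top (volume_unitBall_ne_top n) (by simp)
  have hle : ∀ k : ℕ, hContent n (f '' dyadicBox k 0) *
      Metric.ediam (dyadicBox k (0 : Fin d → ℤ)) ^ m ≤ c * 2⁻¹ ^ k := by
    intro k
    have h2 : ((2 : ENNReal) ^ k)⁻¹ ≤ 1 := ENNReal.inv_le_one.2 (one_le_pow₀ (by norm_num))
    calc _ ≤ volume (Metric.ball (0 : EuclideanSpace ℝ (Fin n)) 1) / 2 ^ n * (K * d) ^ n *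
          (2 ^ k)⁻¹ ^ n * (d * (2 ^ k)⁻¹) ^ m := by
          gcongr
          · exact hContent_image_dyadicBox_le hn hf (hv k)
          · exact ediam_dyadicBox_le k _
      _ ≤ volume (Metric.ball (0 : EuclideanSpace ℝ (Fin n)) 1) / 2 ^ n * (K * d) ^ n *
          (2 ^ k)⁻¹ * (d * 1) ^ m := by
          gcongr
          exact pow_le_of_le_one zero_le h2 hn
      _ = c * 2⁻¹ ^ k := by rw [hc, mul_one, ENNReal.inv_pow]; ring
  have ht : Tendsto (fun k : ℕ => c * (2⁻¹ : ENNReal) ^ k) atTop (nhds (c * 0)) :=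
    ENNReal.Tendsto.const_mul
      (ENNReal.tendsto_pow_atTop_nhds_zero_of_lt_one (by simp)) (Or.inr hc_top)
  rw [mul_zero] at ht
  obtain ⟨k, hk⟩ := (ht.eventually (gt_mem_nhds hδ)).exists
  exact ⟨k, (hle k).trans_lt hk⟩

/-- Coverings indexed by an arbitrary countable type may be used to bound the content: a finite
covering can be padded by cubes of arbitrarily small content. -/
lemma dyadicMapContent_le_tsum {X : Type*} [EMetricSpace X] {n d : ℕ} (m : ℕ) (hn : n ≠ 0)
    {K : NNReal} {f : EuclideanSpace ℝ (Fin d) → X} (hf : LipschitzOnWith K f (unitCube d))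
    {E : Set (EuclideanSpace ℝ (Fin d))} {ι : Type*} [Countable ι]
    (Q : ι → Set (EuclideanSpace ℝ (Fin d))) (hQ : ∀ i, IsDyadicCube (Q i))
    (hE : E ⊆ ⋃ i, Q i) (hsub : ∀ i, Q i ⊆ unitCube d) :
    dyadicMapContent n m d (unitCube d) f E ≤
      ∑' i, hContent n (f '' Q i) * Metric.ediam (Q i) ^ m := by
  refine ENNReal.le_of_forall_pos_le_add fun ε hε _ => ?_
  obtain ⟨δ, hδ, hδsum⟩ := ENNReal.exists_pos_sum_of_countable'
    (ENNReal.coe_ne_zero.2 hε.ne') ℕ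
  choose k hk using fun i => exists_dyadicBox_content_lt m hn hf (hδ i)
  let R : ι ⊕ ℕ → Set (EuclideanSpace ℝ (Fin d)) := Sum.elim Q fun i => dyadicBox (k i) 0
  obtain ⟨e⟩ : Nonempty (ℕ ≃ ι ⊕ ℕ) := nonempty_equiv_of_countable
  have hR : ∀ i, IsDyadicCube (R i) := by
    rintro (i | i)
    exacts [hQ i, isDyadicCube_dyadicBox _ _]
  have hRsub : ∀ i, R i ⊆ unitCube d := by
    rintro (i | i)
    · exact hsub i
    · exact dyadicBox_subset_unitCube (fun _ => le_rfl) fun _ => by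
        simpa using one_le_pow₀ (a := (2 : ℤ)) (by norm_num)
  have hRE : E ⊆ ⋃ i, R (e i) := by
    rw [e.surjective.iUnion_comp R]
    refine hE.trans (iUnion_subset fun i => ?_)
    exact subset_iUnion R (Sum.inl i)
  calc dyadicMapContent n m d (unitCube d) f E
      ≤ ∑' i, hContent n (f '' R (e i)) * Metric.ediam (R (e i)) ^ m :=
        iInf_le_of_le (R ∘ e) <| iInf_le_of_le (fun i => hR _) <| iInf_le_of_le hRE <|
          iInf_le_of_le (fun i => hRsub _) le_rfl
    _ = ∑' i, hContent n (f '' R i) * Metric.ediam (R i) ^ m :=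
        e.tsum_eq fun i => hContent n (f '' R i) * Metric.ediam (R i) ^ m
    _ = ∑' i, hContent n (f '' Q i) * Metric.ediam (Q i) ^ m +
          ∑' i, hContent n (f '' dyadicBox (k i) 0) *
            Metric.ediam (dyadicBox (k i) (0 : Fin d → ℤ)) ^ m :=
        Summable.tsum_sum ENNReal.summable ENNReal.summable
    _ ≤ _ := by
        gcongr
        exact (ENNReal.tsum_le_tsum fun i => (hk i).le).trans hδsum.le

/-- If every point of `E` lies in a dyadic cube whose contribution to the content is at most the
integral of `h` over it, then choosing the largest such cubes gives a disjoint covering. -/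
lemma dyadicMapContent_le_lintegral {X : Type*} [EMetricSpace X] {n d : ℕ} (m : ℕ) (hn : n ≠ 0)
    {K : NNReal} {f : EuclideanSpace ℝ (Fin d) → X} (hf : LipschitzOnWith K f (unitCube d))
    {E : Set (EuclideanSpace ℝ (Fin d))} (hE : E ⊆ unitCube d)
    (h : EuclideanSpace ℝ (Fin d) → ENNReal)
    (hgood : ∀ x ∈ E, ∃ k, hContent n (f '' dyadicBox k (dyadicIndex k x)) * (2 ^ k)⁻¹ ^ m ≤
      ∫⁻ y in dyadicCell k (dyadicIndex k x), h y) :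
    dyadicMapContent n m d (unitCube d) f E ≤ d ^ m * ∫⁻ y, h y := by
  classical
  let good : ℕ → (Fin d → ℤ) → Prop := fun k v =>
    hContent n (f '' dyadicBox k v) * (2 ^ k)⁻¹ ^ m ≤ ∫⁻ y in dyadicCell k v, h y
  let S : Set (ℕ × (Fin d → ℤ)) := {p | ∃ x ∈ E, dyadicIndex p.1 x = p.2 ∧ good p.1 p.2 ∧
    ∀ j < p.1, ¬ good j (dyadicIndex j x)}
  have hcover : E ⊆ ⋃ p : S, dyadicBox p.1.1 p.1.2 := by
    intro x hx
    have hex : ∃ k, good k (dyadicIndex k x) := hgood x hx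
    exact mem_iUnion.2 ⟨⟨(Nat.find hex, dyadicIndex (Nat.find hex) x), x, hx, rfl,
      Nat.find_spec hex, fun j hj => Nat.find_min hex hj⟩,
      mem_dyadicBox_dyadicIndex _ (hE hx)⟩
  have hsub : ∀ p : S, dyadicBox p.1.1 p.1.2 ⊆ unitCube d := by
    rintro ⟨⟨k, v⟩, x, hx, hv, -⟩
    dsimp only at hv ⊢
    exact hv ▸ dyadicBox_dyadicIndex_subset_unitCube k (hE hx)
  have hle : ∀ p q : S, ∀ z ∈ dyadicCell p.1.1 p.1.2, z ∈ dyadicCell q.1.1 q.1.2 →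
      p.1.1 ≤ q.1.1 → p = q := by
    rintro ⟨⟨k, v⟩, x, _, _, hgv, _⟩ ⟨⟨l, w⟩, y, _, hyw, _, hmin⟩ z ⟨_, hzv⟩ ⟨_, hzw⟩ hkl
    dsimp only at hkl hzv hzw hyw hgv hmin
    have hzy : dyadicIndex k z = dyadicIndex k y := dyadicIndex_eq_of_le hkl (hzw.trans hyw.symm)
    have hkl' : k = l := by
      by_contra hne
      refine hmin k (lt_of_le_of_ne hkl hne) ?_
      rwa [← hzy, hzv]
    subst hkl'
    have hvw : v = w := hzv.symm.trans hzw
    subst hvw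
    rfl
  have hdisj : Pairwise (Function.onFun Disjoint fun p : S => dyadicCell p.1.1 p.1.2) := by
    intro p q hpq
    refine Set.disjoint_left.2 fun z hzp hzq => hpq ?_
    rcases le_total p.1.1 q.1.1 with hle' | hle'
    · exact hle p q z hzp hzq hle'
    · exact (hle q p z hzq hzp hle').symm
  calc dyadicMapContent n m d (unitCube d) f E
      ≤ ∑' p : S, hContent n (f '' dyadicBox p.1.1 p.1.2) *
          Metric.ediam (dyadicBox p.1.1 p.1.2) ^ m :=
        dyadicMapContent_le_tsum m hn hf _ (fun p => isDyadicCube_dyadicBox _ _) hcover hsub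
    _ ≤ ∑' p : S, d ^ m * ∫⁻ y in dyadicCell p.1.1 p.1.2, h y := by
        refine ENNReal.tsum_le_tsum fun p => ?_
        have hp : good p.1.1 p.1.2 := by
          obtain ⟨x, -, -, hp, -⟩ := p.2
          exact hp
        calc _ ≤ hContent n (f '' dyadicBox p.1.1 p.1.2) * (d * (2 ^ p.1.1)⁻¹) ^ m := by
              gcongr
              exact ediam_dyadicBox_le _ _
          _ = d ^ m * (hContent n (f '' dyadicBox p.1.1 p.1.2) * (2 ^ p.1.1)⁻¹ ^ m) := by ring
          _ ≤ _ := by gcongr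
    _ = d ^ m * ∫⁻ y in ⋃ p : S, dyadicCell p.1.1 p.1.2, h y := by
        rw [ENNReal.tsum_mul_left,
          lintegral_iUnion (fun p => measurableSet_dyadicCell _ _) hdisj]
    _ ≤ _ := by
        gcongr
        exact Measure.restrict_le_self

/-- The lower `n`-density of `f` along the dyadic cubes containing `x`. -/
noncomputable def dyadicLowerDensity {X : Type*} [EMetricSpace X] (n : ℕ) {d : ℕ}
    (f : EuclideanSpace ℝ (Fin d) → X) (x : EuclideanSpace ℝ (Fin d)) : ENNReal :=
  liminf (fun k : ℕ => hContent n (f '' dyadicBox k (dyadicIndex k x)) * (2 ^ k) ^ n) atTop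

lemma measurable_dyadicLowerDensity {X : Type*} [EMetricSpace X] (n : ℕ) {d : ℕ}
    (f : EuclideanSpace ℝ (Fin d) → X) : Measurable (dyadicLowerDensity n f) := by
  refine Measurable.liminf fun k => ?_
  exact (measurable_of_countable fun v : Fin d → ℤ =>
    hContent n (f '' dyadicBox k v) * (2 ^ k) ^ n).comp (measurable_dyadicIndex k)

lemma dyadicLowerDensity_ne_top {X : Type*} [EMetricSpace X] {n d : ℕ} (hn : n ≠ 0)
    {K : NNReal} {f : EuclideanSpace ℝ (Fin d) → X} (hf : LipschitzOnWith K f (unitCube d))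
    {x : EuclideanSpace ℝ (Fin d)} (hx : x ∈ unitCube d) : dyadicLowerDensity n f x ≠ ⊤ := by
  set c : ENNReal := volume (Metric.ball (0 : EuclideanSpace ℝ (Fin n)) 1) / 2 ^ n * (K * d) ^ n
    with hc
  have hc_top : c ≠ ⊤ :=
    ENNReal.mul_ne_top (ENNReal.div_ne_top (volume_unitBall_ne_top n) (by simp)) (by finiteness)
  have hle : ∀ k : ℕ, hContent n (f '' dyadicBox k (dyadicIndex k x)) * (2 ^ k) ^ n ≤ c := by
    intro k
    calc _ ≤ c * (2 ^ k)⁻¹ ^ n * (2 ^ k) ^ n := by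
          gcongr
          exact hContent_image_dyadicBox_le hn hf (dyadicBox_dyadicIndex_subset_unitCube k hx)
      _ = c := by
          rw [mul_assoc, ← mul_pow, ENNReal.inv_mul_cancel (by simp) (by simp), one_pow, mul_one]
  refine ne_top_of_le_ne_top hc_top ?_
  exact (liminf_le_liminf (Eventually.of_forall hle)).trans_eq (liminf_const c)

lemma dyadicLowerDensity_le_lowerDensity {X : Type*} [MetricSpace X] (n : ℕ) {d : ℕ} (hd : d ≠ 0)
    (f : EuclideanSpace ℝ (Fin d) → X) {x : EuclideanSpace ℝ (Fin d)} (hx : x ∈ unitCube d) :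
    dyadicLowerDensity n f x ≤ volume (Metric.ball (0 : EuclideanSpace ℝ (Fin n)) 1) *
      (2 * d) ^ n * lowerDensity n f x := by
  set ω := volume (Metric.ball (0 : EuclideanSpace ℝ (Fin n)) 1) with hω
  have hω0 : ω ≠ 0 := volume_unitBall_ne_zero n
  have hωt : ω ≠ ⊤ := volume_unitBall_ne_top n
  have hdpos : (0 : ℝ) < d := by positivity
  have hC0 : ω * (2 * d) ^ n ≠ 0 := mul_ne_zero hω0 (pow_ne_zero _ (by simpa using hd))
  have hCt : ω * (2 * d) ^ n ≠ ⊤ := by finiteness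
  refine le_of_forall_lt fun c hc => ?_
  obtain ⟨c', hcc', hc'⟩ := exists_between hc
  refine hcc'.trans_le ?_
  rw [mul_comm, ← ENNReal.div_le_iff hC0 hCt]
  obtain ⟨N, hN⟩ := eventually_atTop.1 (eventually_lt_of_lt_liminf hc')
  refine le_liminf_of_le (h := ?_)
  have hsmall : ∀ᶠ r : ℝ in nhdsWithin 0 (Ioi 0), r ∈ Ioo (0 : ℝ) (d / 2 ^ N) :=
    Ioo_mem_nhdsGT (by positivity)
  filter_upwards [hsmall] with r hr
  obtain ⟨hr0, hrN⟩ := hr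
  have hNr : (2 : ℝ) ^ N < d / r := by
    rw [lt_div_iff₀ hr0]
    rwa [lt_div_iff₀ (by positivity), mul_comm] at hrN
  obtain ⟨l, hl, hl'⟩ := exists_nat_pow_near
    ((one_le_pow₀ (by norm_num : (1 : ℝ) ≤ 2)).trans hNr.le) one_lt_two
  have hNl : N ≤ l + 1 := ((pow_lt_pow_iff_right₀ one_lt_two).1 (hNr.trans hl')).le
  have hball : dyadicBox (l + 1) (dyadicIndex (l + 1) x) ⊆ Metric.ball x r := by
    intro y hy
    refine (dist_le_of_mem_dyadicBox hy (mem_dyadicBox_dyadicIndex _ hx)).trans_lt ?_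
    rwa [div_lt_iff₀ (by positivity), mul_comm, ← div_lt_iff₀ hr0]
  have hpow : (2 : ENNReal) ^ (l + 1) ≤ 2 * d * (ENNReal.ofReal r)⁻¹ := by
    have h1 : (2 : ℝ) ^ (l + 1) ≤ 2 * d * r⁻¹ := by
      rw [pow_succ, mul_assoc, ← div_eq_mul_inv]
      linarith
    have h2 := ENNReal.ofReal_le_ofReal h1
    rw [ENNReal.ofReal_mul (by positivity), ENNReal.ofReal_mul (by norm_num),
      ENNReal.ofReal_pow (by norm_num), ENNReal.ofReal_inv_of_pos hr0] at h2
    simpa using h2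
  rw [ENNReal.div_le_iff hC0 hCt]
  calc c' ≤ hContent n (f '' dyadicBox (l + 1) (dyadicIndex (l + 1) x)) * (2 ^ (l + 1)) ^ n :=
        (hN _ hNl).le
    _ ≤ hContent n (f '' Metric.ball x r) * (2 * d * (ENNReal.ofReal r)⁻¹) ^ n := by
        gcongr
        exact hContent_mono n (image_mono hball)
    _ = (ω⁻¹ * ω) * hContent n (f '' Metric.ball x r) * (2 * d * (ENNReal.ofReal r)⁻¹) ^ n := by
        rw [ENNReal.inv_mul_cancel hω0 hωt, one_mul]
    _ = _ := by
        rw [div_eq_mul_inv, ENNReal.mul_inv (Or.inl hω0) (Or.inl hωt),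
          ENNReal.ofReal_pow hr0.le, mul_pow _ (ENNReal.ofReal r)⁻¹, ENNReal.inv_pow]
        ring

/-- A lower semicontinuous function exceeding the dyadic lower density at `x` dominates, on
average over some small dyadic cube around `x`, the contribution of that cube to the content. -/
lemma exists_content_le_setLIntegral {X : Type*} [EMetricSpace X] {n m : ℕ}
    (f : EuclideanSpace ℝ (Fin (n + m)) → X) {x : EuclideanSpace ℝ (Fin (n + m))}
    (hx : x ∈ unitCube (n + m)) {h : EuclideanSpace ℝ (Fin (n + m)) → ENNReal}
    (hh : LowerSemicontinuous h) (hlt : dyadicLowerDensity n f x < h x) :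
    ∃ k, hContent n (f '' dyadicBox k (dyadicIndex k x)) * (2 ^ k)⁻¹ ^ m ≤
      ∫⁻ y in dyadicCell k (dyadicIndex k x), h y := by
  obtain ⟨t, hgt, hth⟩ := exists_between hlt
  obtain ⟨r, hr, hball⟩ := Metric.eventually_nhds_iff_ball.1 (hh x t hth)
  have hfreq := frequently_lt_of_liminf_lt (h := hgt)
  have htend : Tendsto (fun k : ℕ => ((n + m : ℕ) : ℝ) / 2 ^ k) atTop (nhds 0) :=
    tendsto_const_nhds.div_atTop (tendsto_pow_atTop_atTop_of_one_lt one_lt_two)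
  obtain ⟨k, hkt, hkr⟩ := (hfreq.and_eventually (htend.eventually (gt_mem_nhds hr))).exists
  refine ⟨k, ?_⟩
  have h0 : (2 : ENNReal) ^ k ≠ 0 := by simp
  have htop : (2 : ENNReal) ^ k ≠ ⊤ := by simp
  calc hContent n (f '' dyadicBox k (dyadicIndex k x)) * (2 ^ k)⁻¹ ^ m
      = hContent n (f '' dyadicBox k (dyadicIndex k x)) * (2 ^ k * (2 ^ k)⁻¹) ^ n *
          (2 ^ k)⁻¹ ^ m := by rw [ENNReal.mul_inv_cancel h0 htop, one_pow, mul_one]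
    _ = hContent n (f '' dyadicBox k (dyadicIndex k x)) * (2 ^ k) ^ n *
          (2 ^ k)⁻¹ ^ (n + m) := by rw [mul_pow, pow_add]; ring
    _ ≤ t * volume (dyadicCell k (dyadicIndex k x)) := by
        gcongr
        exact le_volume_dyadicCell (dyadicIndex_nonneg k hx) (dyadicIndex_add_one_le k x)
    _ = ∫⁻ _ in dyadicCell k (dyadicIndex k x), t := (setLIntegral_const _ _).symm
    _ ≤ _ := setLIntegral_mono' (measurableSet_dyadicCell _ _) fun y hy => by
        refine (hball y ?_).le
        exact (dist_le_of_mem_dyadicBox (dyadicCell_subset_dyadicBox _ _ hy)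
          (mem_dyadicBox_dyadicIndex k hx)).trans_lt hkr

lemma dyadicMapContent_le_setLIntegral_dyadicLowerDensity {X : Type*} [EMetricSpace X] {n m : ℕ}
    (hn : n ≠ 0) {K : NNReal} {f : EuclideanSpace ℝ (Fin (n + m)) → X}
    (hf : LipschitzOnWith K f (unitCube (n + m))) {E : Set (EuclideanSpace ℝ (Fin (n + m)))}
    (hEm : MeasurableSet E) (hE : E ⊆ unitCube (n + m)) :
    dyadicMapContent n m (n + m) (unitCube (n + m)) f E ≤
      (n + m : ℕ) ^ m * ∫⁻ x in E, dyadicLowerDensity n f x := by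
  let g : EuclideanSpace ℝ (Fin (n + m)) → NNReal :=
    fun x => (E.indicator (dyadicLowerDensity n f) x).toNNReal
  have hgm : Measurable g := ((measurable_dyadicLowerDensity n f).indicator hEm).ennreal_toNNReal
  have hg : ∀ x, (g x : ENNReal) = E.indicator (dyadicLowerDensity n f) x := fun x => by
    refine ENNReal.coe_toNNReal ?_
    by_cases hx : x ∈ E
    · rw [indicator_of_mem hx]
      exact dyadicLowerDensity_ne_top hn hf (hE hx)
    · simp [hx]
  have hgint : ∫⁻ x, g x = ∫⁻ x in E, dyadicLowerDensity n f x := by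
    simp_rw [hg, lintegral_indicator hEm]
  have hd : (((n + m : ℕ) : ENNReal) ^ m) ≠ 0 := pow_ne_zero _ (by simp [hn])
  have hdt : (((n + m : ℕ) : ENNReal) ^ m) ≠ ⊤ := by finiteness
  rw [mul_comm, ← ENNReal.div_le_iff hd hdt]
  refine ENNReal.le_of_forall_pos_le_add fun ε hε _ => ?_
  obtain ⟨h, hgh, hh, hhle⟩ := exists_lt_lowerSemicontinuous_lintegral_ge
    volume g hgm (ENNReal.coe_ne_zero.2 hε.ne')
  rw [ENNReal.div_le_iff hd hdt, mul_comm]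
  refine (dyadicMapContent_le_lintegral m hn hf hE h fun x hx => ?_).trans ?_
  · refine exists_content_le_setLIntegral f (hE hx) hh ?_
    simpa [hg, hx] using hgh x
  · rw [← hgint]
    gcongr

universe u

/-- For a Lipschitz map `f : [0,1]^{n+m} → X` and measurable `E`,
`H^{n,m}_∞(f,E) ≲_{n,m} ∫_E Θⁿ_*(f,x) dH^{n+m}(x)`. -/
theorem stmt_15 (n m : ℕ) (hn : 1 ≤ n) :
    ∃ C : NNReal, ∀ (X : Type u) [MetricSpace X] (K : NNReal)
      (f : EuclideanSpace ℝ (Fin (n + m)) → X)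
      (_ : LipschitzOnWith K f (unitCube (n + m)))
      (E : Set (EuclideanSpace ℝ (Fin (n + m))))
      (_ : MeasurableSet E) (_ : E ⊆ unitCube (n + m)),
      dyadicMapContent n m (n + m) (unitCube (n + m)) f E ≤
        (C : ENNReal) * ∫⁻ x in E, lowerDensity n f x ∂volume := by
  refine ⟨((n + m : ℕ) : NNReal) ^ m *
    ((volume (Metric.ball (0 : EuclideanSpace ℝ (Fin n)) 1)).toNNReal *
      (2 * ((n + m : ℕ) : NNReal)) ^ n), ?_⟩
  intro X _ K f hf E hEm hE
  have hn' : n ≠ 0 := by omega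
  refine (dyadicMapContent_le_setLIntegral_dyadicLowerDensity hn' hf hEm hE).trans ?_
  simp only [ENNReal.coe_mul, ENNReal.coe_pow, ENNReal.coe_natCast, ENNReal.coe_ofNat,
    ENNReal.coe_toNNReal (volume_unitBall_ne_top n)]
  have hω := volume_unitBall_ne_top n
  rw [mul_assoc]
  gcongr
  rw [← lintegral_const_mul' _ _ (by finiteness)]
  exact setLIntegral_mono' hEm fun x hx =>
    dyadicLowerDensity_le_lowerDensity n (by omega) f (hE hx)
end
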